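/- Assume the resonance condition, assume (a₁,a₂) belongs to the resolubility set R (i.e. Λ₁(π) < α₁ < Λ₁(0)), and let r ≥ 1 be an integer such that c_{r,2} := (1/π)·∫₀^{2π} C₂(t)·cos(rnt) dt ≠ 0. Let p₁ be continuous, 2π-periodic and such that Φ₁(θ) = 0 for every θ ∈ ℝ, and let φ₁, φ₂ satisfy the standing hypotheses with φ₁(+∞) ≠ 0. Then there exists μ* > 0 such that for every μ > μ*, taking p₂(t) = μ·cos(rnt), there exist two Lebesgue-measurable sets E⁺, E⁻ ⊆ ℝ⁴ of infinite Lebesgue measure such that: every C² solution x = (x₁,x₂) : [0,∞) → ℝ² of (S) with (x₁(0), x₂(0), ẋ₁(0), ẋ₂(0)) ∈ E⁺ satisfies lim_{t→+∞} (x_i(t)² + ẋ_i(t)²) = +∞ for i = 1,2, and every C² solution x : (−∞,0] → ℝ² of (S) with (x₁(0), x₂(0), ẋ₁(0), ẋ₂(0)) ∈ E⁻ satisfies lim_{t→−∞} (x_i(t)² + ẋ_i(t)²) = +∞ for i = 1,2. -/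

import Mathlib

open Real MeasureTheory Filter

noncomputable section

/-- `C` is the asymmetric cosine of the pair `(a, b)` for the resonance integer `n`:
the even, `2π/n`-periodic function equal to `cos(√a t)` on `[0, π/(2√a)]` and to
`−√(a/b)·sin(√b(t − π/(2√a)))` on `[π/(2√a), π/n]`. -/
def IsAsymCos (n : ℕ) (a b : ℝ) (C : ℝ → ℝ) : Prop :=
  (∀ t, C (-t) = C t) ∧ (∀ t, C (t + 2 * π / n) = C t) ∧
  (∀ t ∈ Set.Icc (0 : ℝ) (π / (2 * Real.sqrt a)), C t = Real.cos (Real.sqrt a * t)) ∧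
  (∀ t ∈ Set.Icc (π / (2 * Real.sqrt a)) (π / n),
      C t = - Real.sqrt (a / b) * Real.sin (Real.sqrt b * (t - π / (2 * Real.sqrt a))))


/-! ### The piecewise linear restoring force -/

def gg (a b x : ℝ) : ℝ := a * max x 0 - b * max (-x) 0

lemma gg_nonneg_arg {a b x : ℝ} (hx : 0 ≤ x) : gg a b x = a * x := by
  unfold gg
  rw [max_eq_left hx, max_eq_right (by linarith)]; ring

lemma gg_nonpos_arg {a b x : ℝ} (hx : x ≤ 0) : gg a b x = b * x := by
  unfold gg
  rw [max_eq_right hx, max_eq_left (by linarith)]; ring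

lemma gg_continuous (a b : ℝ) : Continuous (gg a b) := by
  unfold gg; fun_prop

lemma gg_lip {a b : ℝ} (ha : 0 < a) (hb : 0 < b) (x y : ℝ) :
    |gg a b x - gg a b y| ≤ (a + b) * |x - y| := by
  have h1 : |max x 0 - max y 0| ≤ |x - y| := abs_max_sub_max_le_abs x y 0
  have h2 : |max (-x) 0 - max (-y) 0| ≤ |x - y| := by
    have := abs_max_sub_max_le_abs (-x) (-y) 0
    rwa [show -x - -y = -(x - y) by ring, abs_neg] at this
  have : gg a b x - gg a b y
      = a * (max x 0 - max y 0) - b * (max (-x) 0 - max (-y) 0) := by unfold gg; ring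
  rw [this]
  calc _ ≤ |a * (max x 0 - max y 0)| + |b * (max (-x) 0 - max (-y) 0)| := abs_sub _ _
    _ = a * |max x 0 - max y 0| + b * |max (-x) 0 - max (-y) 0| := by
        rw [abs_mul, abs_mul, abs_of_pos ha, abs_of_pos hb]
    _ ≤ a * |x - y| + b * |x - y| := by gcongr
    _ = _ := by ring

lemma gg_zero (a b : ℝ) : gg a b 0 = 0 := by simp [gg]

lemma gg_smul {a b r : ℝ} (hr : 0 ≤ r) (x : ℝ) : gg a b (r * x) = r * gg a b x := by
  rcases le_total 0 x with h | h
  · rw [gg_nonneg_arg h, gg_nonneg_arg (mul_nonneg hr h)]; ring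
  · rw [gg_nonpos_arg h, gg_nonpos_arg (mul_nonpos_of_nonneg_of_nonpos hr h)]; ring

lemma gg_mul_le {a b : ℝ} (ha : 0 < a) (hb : 0 < b) (x : ℝ) :
    gg a b x * x ≤ (a + b) * x ^ 2 := by
  rcases le_total 0 x with h | h
  · rw [gg_nonneg_arg h]; nlinarith [mul_nonneg hb.le (sq_nonneg x)]
  · rw [gg_nonpos_arg h]; nlinarith [mul_nonneg ha.le (sq_nonneg x)]

lemma gg_mul_ge (a b : ℝ) (x : ℝ) :
    min a b * x ^ 2 ≤ gg a b x * x := by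
  rcases le_total 0 x with h | h
  · rw [gg_nonneg_arg h]; nlinarith [mul_le_mul_of_nonneg_right (min_le_left a b) (sq_nonneg x)]
  · rw [gg_nonpos_arg h]; nlinarith [mul_le_mul_of_nonneg_right (min_le_right a b) (sq_nonneg x)]

lemma hasDerivAt_gg_mul (a b x : ℝ) :
    HasDerivAt (fun y => gg a b y * y) (2 * gg a b x) x := by
  rcases lt_trichotomy x 0 with h | h | h
  · have h1 : HasDerivAt (fun y : ℝ => b * y * y) (2 * gg a b x) x := by
      rw [gg_nonpos_arg h.le]
      exact (((hasDerivAt_id' x).const_mul b).mul (hasDerivAt_id' x)).congr_deriv (by ring)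
    refine h1.congr_of_eventuallyEq ?_
    filter_upwards [Iio_mem_nhds h] with y hy
    rw [gg_nonpos_arg (le_of_lt hy)]
  · subst h
    rw [gg_zero, mul_zero, hasDerivAt_iff_isLittleO]
    simp only [gg_zero, mul_zero, sub_zero, smul_zero]
    have : Tendsto (gg a b) (nhds 0) (nhds 0) := by
      simpa [gg_zero] using (gg_continuous a b).tendsto 0
    have h1 : (fun y => gg a b y) =o[nhds 0] (fun _ => (1:ℝ)) :=
      (Asymptotics.isLittleO_one_iff ℝ).2 this
    have := h1.mul_isBigO (Asymptotics.isBigO_refl (fun y : ℝ => y) (nhds 0))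
    simpa using this
  · have h1 : HasDerivAt (fun y : ℝ => a * y * y) (2 * gg a b x) x := by
      rw [gg_nonneg_arg h.le]
      exact (((hasDerivAt_id' x).const_mul a).mul (hasDerivAt_id' x)).congr_deriv (by ring)
    refine h1.congr_of_eventuallyEq ?_
    filter_upwards [Ioi_mem_nhds h] with y hy
    rw [gg_nonneg_arg (le_of_lt hy)]

lemma gg_cross {a b x c r K : ℝ} (ha : 0 < a) (hb : 0 < b) (hr : 0 < r)
    (hK : |x - r * c| ≤ K) :
    |gg a b x * c - x * gg a b c| ≤ (a + b) * K ^ 2 / r := by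
  have hK0 : 0 ≤ K := (abs_nonneg _).trans hK
  have hR : 0 ≤ (a + b) * K ^ 2 / r := by positivity
  obtain ⟨h1, h2⟩ := abs_le.1 hK
  have key : ∀ s t : ℝ, 0 ≤ s → 0 ≤ t → s ≤ K → r * t ≤ K → |(a - b) * (s * t)| ≤ (a + b) * K ^ 2 / r := by
    intro s t hs ht hsK htK
    rw [abs_mul, abs_of_nonneg (mul_nonneg hs ht), le_div_iff₀ hr]
    have : |a - b| ≤ a + b := by rw [abs_le]; constructor <;> linarith
    have h3 : s * (r * t) ≤ K * K := mul_le_mul hsK htK (by positivity) hK0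
    calc |a - b| * (s * t) * r = |a - b| * (s * (r * t)) := by ring
      _ ≤ (a + b) * (K * K) := by gcongr
      _ = _ := by ring
  rcases le_total 0 x with hx | hx <;> rcases le_total 0 c with hc | hc
  · rw [gg_nonneg_arg hx, gg_nonneg_arg hc]; rw [show ∀ u v w : ℝ, u * v * w - v * (u * w) = 0 from fun u v w => by ring, abs_zero]; exact hR
  · rw [gg_nonneg_arg hx, gg_nonpos_arg hc]
    have := key x (-c) hx (by linarith) (by nlinarith) (by nlinarith)
    rw [← abs_neg]; convert this using 2; ring
  · rw [gg_nonpos_arg hx, gg_nonneg_arg hc]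
    have := key (-x) c (by linarith) hc (by nlinarith) (by nlinarith)
    convert this using 2; ring
  · rw [gg_nonpos_arg hx, gg_nonpos_arg hc]; rw [show ∀ u v w : ℝ, u * v * w - v * (u * w) = 0 from fun u v w => by ring, abs_zero]; exact hR

/-! ### Abstract oscillator -/

structure Osc (a b T : ℝ) (C S : ℝ → ℝ) : Prop where
  ha : 0 < a
  hb : 0 < b
  dC : ∀ t, HasDerivAt C (S t) t
  dS : ∀ t, HasDerivAt S (-(gg a b (C t))) t
  perC : ∀ t, C (t + T) = C t
  perS : ∀ t, S (t + T) = S t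
  en : ∀ t, S t ^ 2 + gg a b (C t) * C t = a

namespace Osc
variable {a b T : ℝ} {C S : ℝ → ℝ}

lemma contC (o : Osc a b T C S) : Continuous C :=
  continuous_iff_continuousAt.2 fun t => (o.dC t).continuousAt
lemma contS (o : Osc a b T C S) : Continuous S :=
  continuous_iff_continuousAt.2 fun t => (o.dS t).continuousAt

lemma bounds (o : Osc a b T C S) : ∃ B : ℝ, 1 ≤ B ∧ ∀ t, |C t| ≤ B ∧ |S t| ≤ B := by
  have hm : 0 < min a b := lt_min o.ha o.hb
  refine ⟨1 + a + a / min a b, by have := o.ha; have := div_pos o.ha hm; linarith, fun t => ?_⟩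
  have h := o.en t
  have h1 := gg_mul_ge a b (C t)
  have hp := div_pos o.ha hm
  have ha := o.ha
  have hC : (C t) ^ 2 ≤ a / min a b := by
    rw [le_div_iff₀ hm]; nlinarith [sq_nonneg (S t)]
  have hS : S t ^ 2 ≤ a := by nlinarith [mul_nonneg hm.le (sq_nonneg (C t))]
  constructor
  · apply abs_le_of_sq_le_sq _ (by linarith); nlinarith
  · apply abs_le_of_sq_le_sq _ (by linarith); nlinarith

lemma lower (o : Osc a b T C S) (t : ℝ) : a ≤ (1 + a + b) * (C t ^ 2 + S t ^ 2) := by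
  have := gg_mul_le o.ha o.hb (C t)
  have := o.en t
  have := o.ha; have := o.hb
  nlinarith [sq_nonneg (S t), sq_nonneg (C t)]

/-- The determinant `D(σ,τ)` is at least `(a/2)(τ-σ)` for close angles. -/
lemma det_lower (o : Osc a b T C S) : ∃ w > 0, ∀ σ τ, σ ≤ τ → τ ≤ σ + w →
    a / 2 * (τ - σ) ≤ C τ * S σ - S τ * C σ := by
  obtain ⟨B, hB1, hB⟩ := o.bounds
  have ha := o.ha
  have hb := o.hb
  have hlipC : ∀ s t, |C t - C s| ≤ B * |t - s| := by
    intro s t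
    have := Convex.norm_image_sub_le_of_norm_hasDerivWithin_le (f := C) (f' := S) (s := Set.univ) (C := B)
      (x := s) (y := t) (fun x _ => (o.dC x).hasDerivWithinAt) (fun x _ => (hB x).2) convex_univ trivial trivial
    simpa using this
  have hgb : ∀ t, |gg a b (C t)| ≤ (a + b) * B := by
    intro t
    have := gg_lip ha hb (C t) 0
    rw [gg_zero, sub_zero, sub_zero] at this
    exact this.trans (by gcongr; exact (hB t).1)
  have hlipS : ∀ s t, |S t - S s| ≤ (a + b) * B * |t - s| := by
    intro s t
    have := Convex.norm_image_sub_le_of_norm_hasDerivWithin_le (f := S) (f' := fun t => -(gg a b (C t))) (s := Set.univ)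
      (C := (a + b) * B)
      (x := s) (y := t) (fun x _ => (o.dS x).hasDerivWithinAt) (fun x _ => by simpa using hgb x) convex_univ trivial trivial
    simpa using this
  have hQ : 0 < 2 * (a + b) * B ^ 2 := by positivity
  refine ⟨a / 2 / (2 * (a + b) * B ^ 2), by positivity, fun σ τ h1 h2 => ?_⟩
  have hd : ∀ t, HasDerivAt (fun t => C t * S σ - S t * C σ - a / 2 * (t - σ))
      (S t * S σ - (-(gg a b (C t))) * C σ - a / 2 * 1) t := by
    intro t
    exact (((o.dC t).mul_const _).sub ((o.dS t).mul_const _)).sub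
      (((hasDerivAt_id t).sub_const σ).const_mul (a / 2))
  have hmono : MonotoneOn (fun t => C t * S σ - S t * C σ - a / 2 * (t - σ)) (Set.Icc σ τ) := by
    apply monotoneOn_of_deriv_nonneg (convex_Icc _ _)
    · exact fun t _ => (hd t).continuousAt.continuousWithinAt
    · exact fun t _ => (hd t).differentiableAt.differentiableWithinAt
    · intro t ht
      rw [interior_Icc] at ht
      rw [(hd t).deriv]
      have e := o.en σ
      have hts : |t - σ| ≤ a / 2 / (2 * (a + b) * B ^ 2) := by
        rw [abs_of_pos (by linarith [ht.1])]; linarith [ht.2]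
      have i1 : |S σ * (S t - S σ)| ≤ B * ((a + b) * B * |t - σ|) := by
        rw [abs_mul]; exact mul_le_mul (hB σ).2 (hlipS σ t) (abs_nonneg _) (by linarith)
      have i2 : |C σ * (gg a b (C t) - gg a b (C σ))| ≤ B * ((a + b) * (B * |t - σ|)) := by
        rw [abs_mul]
        refine mul_le_mul (hB σ).1 ((gg_lip ha hb _ _).trans ?_) (abs_nonneg _) (by linarith)
        gcongr; exact hlipC σ t
      have i3 : 2 * (a + b) * B ^ 2 * |t - σ| ≤ a / 2 := by
        rwa [le_div_iff₀ hQ, mul_comm] at hts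
      have := neg_le_of_abs_le i1
      have := neg_le_of_abs_le i2
      nlinarith
  have := hmono ⟨le_refl σ, h1⟩ ⟨h1, le_refl τ⟩ h1
  simp only [sub_self, mul_zero, sub_zero] at this
  nlinarith

/-- Polar representation inside a thin sector. -/
lemma polar (o : Osc a b T C S) {w : ℝ} (hw : ∀ σ τ, σ ≤ τ → τ ≤ σ + w →
    a / 2 * (τ - σ) ≤ C τ * S σ - S τ * C σ) {s₁ s₂ : ℝ} (h12 : s₁ < s₂) (h21 : s₂ ≤ s₁ + w)
    {x v : ℝ} (hne : 0 < v ^ 2 + gg a b x * x) (hW1 : 0 ≤ x * S s₁ - v * C s₁)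
    (hW2 : x * S s₂ - v * C s₂ ≤ 0) :
    ∃ r > 0, ∃ τ ∈ Set.Icc s₁ s₂, x = r * C τ ∧ v = r * S τ := by
  have hc : ContinuousOn (fun τ => x * S τ - v * C τ) (Set.Icc s₁ s₂) := by
    have := o.contC; have := o.contS
    fun_prop
  obtain ⟨τ, hτ, h0⟩ := intermediate_value_Icc' h12.le hc ⟨hW2, hW1⟩
  simp only at h0
  have ha := o.ha
  have e := o.en τ
  have hx : x = (v * S τ + x * gg a b (C τ)) / a * C τ := by
    field_simp; linear_combination S τ * h0 - x * e
  have hv : v = (v * S τ + x * gg a b (C τ)) / a * S τ := by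
    field_simp; linear_combination (- gg a b (C τ)) * h0 - v * e
  set l := (v * S τ + x * gg a b (C τ)) / a
  rcases lt_trichotomy l 0 with hl | hl | hl
  · exfalso
    have d1 := hw s₁ τ hτ.1 (by linarith [hτ.2])
    have d2 := hw τ s₂ hτ.2 (by linarith [hτ.1])
    rw [hx, hv] at hW1 hW2
    have e1 : 0 ≤ l * (C τ * S s₁ - S τ * C s₁) := by nlinarith
    have e2 : 0 ≤ l * (C s₂ * S τ - S s₂ * C τ) := by nlinarith
    have f1 : C τ * S s₁ - S τ * C s₁ ≤ 0 := by
      by_contra hcon; push Not at hcon; nlinarith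
    have f2 : C s₂ * S τ - S s₂ * C τ ≤ 0 := by
      by_contra hcon; push Not at hcon; nlinarith
    nlinarith
  · exfalso
    rw [hl, zero_mul] at hx hv
    rw [hx, hv, gg_zero] at hne
    simp at hne
  · exact ⟨l, hl, τ, hτ, hx, hv⟩

end Osc

/-- `(x, v)` solves the forced oscillator on one forcing period `[0, 2π]`. -/
def Sol (a b : ℝ) (f x v : ℝ → ℝ) : Prop :=
  ∀ t ∈ Set.Icc (0:ℝ) (2 * π), HasDerivAt x (v t) t ∧ HasDerivAt v (f t - gg a b (x t)) t

namespace Osc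
variable {a b T : ℝ} {C S : ℝ → ℝ}

lemma dCs (o : Osc a b T C S) (τ t : ℝ) : HasDerivAt (fun t => C (t + τ)) (S (t + τ)) t :=
  (o.dC (t + τ)).comp_add_const t τ
lemma dSs (o : Osc a b T C S) (τ t : ℝ) :
    HasDerivAt (fun t => S (t + τ)) (-(gg a b (C (t + τ)))) t :=
  (o.dS (t + τ)).comp_add_const t τ

lemma lipC (o : Osc a b T C S) {B : ℝ} (hB : ∀ t, |C t| ≤ B ∧ |S t| ≤ B) (s t : ℝ) :
    |C t - C s| ≤ B * |t - s| := by
  have := Convex.norm_image_sub_le_of_norm_hasDerivWithin_le (f := C) (f' := S) (s := Set.univ)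
    (C := B) (x := s) (y := t) (fun x _ => (o.dC x).hasDerivWithinAt) (fun x _ => (hB x).2)
    convex_univ trivial trivial
  simpa using this

/-- Bounded distance to the free motion over one period. -/
lemma approx (o : Osc a b T C S) (F : ℝ) (hF : 0 ≤ F) : ∃ K ≥ 0, ∀ (r τ : ℝ) (f x v : ℝ → ℝ),
    0 ≤ r → Sol a b f x v → (∀ t ∈ Set.Icc (0:ℝ) (2 * π), |f t| ≤ F) →
    x 0 = r * C τ → v 0 = r * S τ →
    ∀ t ∈ Set.Icc (0:ℝ) (2 * π), |x t - r * C (t + τ)| ≤ K ∧ |v t - r * S (t + τ)| ≤ K := by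
  have ha := o.ha
  have hb := o.hb
  have hL : 0 < 1 + a + b := by linarith
  have hK : ∀ t, 0 ≤ t → 0 ≤ gronwallBound 0 (1 + a + b) F t := by
    intro t ht
    have := gronwallBound_mono (le_refl (0:ℝ)) hF hL.le ht
    rwa [gronwallBound_x0] at this
  refine ⟨gronwallBound 0 (1 + a + b) F (2 * π), hK _ (by positivity), ?_⟩
  intro r τ f x v hr hs hf hx0 hv0 t ht
  let z : ℝ → ℝ × ℝ := fun t => (x t - r * C (t + τ), v t - r * S (t + τ))
  let z' : ℝ → ℝ × ℝ := fun t => (v t - r * S (t + τ),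
    f t - gg a b (x t) - r * (-(gg a b (C (t + τ)))))
  have hz : ∀ t ∈ Set.Icc (0:ℝ) (2 * π), HasDerivAt z (z' t) t := by
    intro t ht
    exact ((hs t ht).1.sub ((o.dCs τ t).const_mul r)).prodMk
      ((hs t ht).2.sub ((o.dSs τ t).const_mul r))
  have := norm_le_gronwallBound_of_norm_deriv_right_le (f := z) (f' := z') (δ := 0)
    (K := 1 + a + b) (ε := F) (a := 0) (b := 2 * π)
    (fun t ht => (hz t ht).continuousAt.continuousWithinAt)
    (fun t ht => (hz t ⟨ht.1, ht.2.le⟩).hasDerivWithinAt)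
    (by simp [z, hx0, hv0])
    (by
      intro t ht
      have ht' : t ∈ Set.Icc (0:ℝ) (2 * π) := ⟨ht.1, ht.2.le⟩
      have n1 : |x t - r * C (t + τ)| ≤ ‖z t‖ := norm_fst_le (z t)
      have n2 : |v t - r * S (t + τ)| ≤ ‖z t‖ := norm_snd_le (z t)
      have hn : 0 ≤ ‖z t‖ := norm_nonneg _
      rw [Prod.norm_def]
      refine max_le ?_ ?_
      · show |v t - r * S (t + τ)| ≤ _
        nlinarith
      · show |f t - gg a b (x t) - r * (-(gg a b (C (t + τ))))| ≤ _
        have h1 := gg_lip ha hb (x t) (r * C (t + τ))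
        rw [gg_smul hr] at h1
        have h2 := hf t ht'
        have h3 := abs_le.1 h1
        have h4 := abs_le.1 h2
        have h5 : (a + b) * |x t - r * C (t + τ)| ≤ (a + b) * ‖z t‖ := by gcongr
        rw [abs_le]; constructor <;> nlinarith)
    t ht
  have hle : gronwallBound 0 (1 + a + b) F (t - 0) ≤ gronwallBound 0 (1 + a + b) F (2 * π) :=
    gronwallBound_mono (le_refl (0:ℝ)) hF hL.le (by linarith [ht.2])
  exact ⟨(norm_fst_le (z t)).trans (this.trans hle), (norm_snd_le (z t)).trans (this.trans hle)⟩

lemma Sol.contX {f x v : ℝ → ℝ} (h : Sol a b f x v) : ContinuousOn x (Set.Icc 0 (2 * π)) :=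
  fun t ht => (h t ht).1.continuousAt.continuousWithinAt
lemma Sol.contV {f x v : ℝ → ℝ} (h : Sol a b f x v) : ContinuousOn v (Set.Icc 0 (2 * π)) :=
  fun t ht => (h t ht).2.continuousAt.continuousWithinAt

lemma twopi_uIcc : Set.uIcc (0:ℝ) (2 * π) = Set.Icc 0 (2 * π) :=
  Set.uIcc_of_le (by positivity)

lemma ii_of_cont {f : ℝ → ℝ} (h : ContinuousOn f (Set.Icc 0 (2 * π))) :
    IntervalIntegrable f volume 0 (2 * π) := by
  apply ContinuousOn.intervalIntegrable; rwa [twopi_uIcc]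

lemma abs_int_le {f : ℝ → ℝ} {M : ℝ} (h : ∀ t ∈ Set.Icc (0:ℝ) (2 * π), |f t| ≤ M) :
    |∫ t in (0:ℝ)..(2 * π), f t| ≤ M * (2 * π) := by
  have := intervalIntegral.norm_integral_le_of_norm_le_const (a := 0) (b := 2 * π) (f := f) (C := M)
    (fun t ht => h t (by rw [← twopi_uIcc]; exact Set.uIoc_subset_uIcc ht))
  rwa [sub_zero, abs_of_pos (by positivity : (0:ℝ) < 2 * π)] at this

/-- Increment of the Wronskian over one period. -/
lemma wronskian (o : Osc a b (2 * π) C S) {K r σ : ℝ} {f x v : ℝ → ℝ} (hr : 0 < r)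
    (hs : Sol a b f x v) (hfc : ContinuousOn f (Set.Icc 0 (2 * π)))
    (hK : ∀ t ∈ Set.Icc (0:ℝ) (2 * π), |x t - r * C (t + σ)| ≤ K) :
    |(x (2 * π) * S σ - v (2 * π) * C σ) - (x 0 * S σ - v 0 * C σ)
      + ∫ t in (0:ℝ)..(2 * π), f t * C (t + σ)| ≤ (a + b) * K ^ 2 / r * (2 * π) := by
  have cC := o.contC
  have cS := o.contS
  have cg := gg_continuous a b
  have cx := Sol.contX hs
  have hi1 : IntervalIntegrable (fun t => gg a b (x t) * C (t + σ) - x t * gg a b (C (t + σ)))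
      volume 0 (2 * π) := by
    apply ii_of_cont
    have : ContinuousOn (fun t => gg a b (x t)) (Set.Icc 0 (2 * π)) := cg.comp_continuousOn cx
    fun_prop
  have hi2 : IntervalIntegrable (fun t => f t * C (t + σ)) volume 0 (2 * π) := by
    apply ii_of_cont; fun_prop
  have hd : ∀ t ∈ Set.uIcc (0:ℝ) (2 * π),
      HasDerivAt (fun t => x t * S (t + σ) - v t * C (t + σ))
      ((gg a b (x t) * C (t + σ) - x t * gg a b (C (t + σ))) - f t * C (t + σ)) t := by
    intro t ht
    rw [twopi_uIcc] at ht
    exact (((hs t ht).1.mul (o.dSs σ t)).sub ((hs t ht).2.mul (o.dCs σ t))).congr_deriv (by ring)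
  have := intervalIntegral.integral_eq_sub_of_hasDerivAt hd (hi1.sub hi2)
  rw [intervalIntegral.integral_sub hi1 hi2] at this
  simp only [zero_add] at this
  rw [show 2 * π + σ = σ + 2 * π by ring, o.perC, o.perS] at this
  rw [← this, sub_add_cancel]
  exact abs_int_le fun t ht => gg_cross o.ha o.hb hr (hK t ht)

/-- Increment of the energy over one period. -/
lemma energy (o : Osc a b (2 * π) C S) {K r τ F : ℝ} {f x v : ℝ → ℝ}
    (hs : Sol a b f x v) (hfc : ContinuousOn f (Set.Icc 0 (2 * π)))
    (hF : ∀ t ∈ Set.Icc (0:ℝ) (2 * π), |f t| ≤ F)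
    (hK : ∀ t ∈ Set.Icc (0:ℝ) (2 * π), |v t - r * S (t + τ)| ≤ K) :
    |(v (2 * π) ^ 2 + gg a b (x (2 * π)) * x (2 * π)) - (v 0 ^ 2 + gg a b (x 0) * x 0)
      - 2 * r * ∫ t in (0:ℝ)..(2 * π), f t * S (t + τ)| ≤ 2 * (F * K) * (2 * π) := by
  have cS := o.contS
  have cv := Sol.contV hs
  have hi1 : IntervalIntegrable (fun t => 2 * r * (f t * S (t + τ))) volume 0 (2 * π) := by
    apply ii_of_cont; fun_prop
  have hi2 : IntervalIntegrable (fun t => 2 * (f t * (v t - r * S (t + τ)))) volume 0 (2 * π) := by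
    apply ii_of_cont; fun_prop
  have hd : ∀ t ∈ Set.uIcc (0:ℝ) (2 * π),
      HasDerivAt (fun t => v t ^ 2 + gg a b (x t) * x t)
      (2 * r * (f t * S (t + τ)) + 2 * (f t * (v t - r * S (t + τ)))) t := by
    intro t ht
    rw [twopi_uIcc] at ht
    have h1 := (hasDerivAt_gg_mul a b (x t)).comp t (hs t ht).1
    exact (((hs t ht).2.pow 2).add h1).congr_deriv (by push_cast; ring)
  have := intervalIntegral.integral_eq_sub_of_hasDerivAt hd (hi1.add hi2)
  rw [intervalIntegral.integral_add hi1 hi2, intervalIntegral.integral_const_mul] at this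
  rw [← this, add_sub_cancel_left]
  refine abs_int_le fun t ht => ?_
  rw [abs_mul, abs_mul, abs_two]
  have := hF t ht
  have h0 := (abs_nonneg _).trans this
  gcongr
  exact hK t ht

set_option maxHeartbeats 1000000 in
/-- One step of the stroboscopic map keeps the sector and increases the radius. -/
lemma step (o : Osc a b (2 * π) C S) {w : ℝ} (hw : ∀ σ τ, σ ≤ τ → τ ≤ σ + w →
    a / 2 * (τ - σ) ≤ C τ * S σ - S τ * C σ) {s₁ s₂ F c K : ℝ} (h12 : s₁ < s₂)
    (h21 : s₂ ≤ s₁ + w) (hF : 0 ≤ F) (hc : 0 < c) (hK : 0 ≤ K) :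
    ∃ R > 0, ∀ (r τ : ℝ) (f x v : ℝ → ℝ), R ≤ r → τ ∈ Set.Icc s₁ s₂ → Sol a b f x v →
    ContinuousOn f (Set.Icc 0 (2 * π)) → (∀ t ∈ Set.Icc (0:ℝ) (2 * π), |f t| ≤ F) →
    x 0 = r * C τ → v 0 = r * S τ →
    (∀ t ∈ Set.Icc (0:ℝ) (2 * π), |x t - r * C (t + τ)| ≤ K ∧ |v t - r * S (t + τ)| ≤ K) →
    c ≤ ∫ t in (0:ℝ)..(2 * π), f t * S (t + τ) →
    (∫ t in (0:ℝ)..(2 * π), f t * C (t + s₁)) ≤ -c →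
    c ≤ ∫ t in (0:ℝ)..(2 * π), f t * C (t + s₂) →
    ∃ r' τ', r + c / (2 * a) ≤ r' ∧ τ' ∈ Set.Icc s₁ s₂ ∧ x (2 * π) = r' * C τ' ∧
      v (2 * π) = r' * S τ' := by
  obtain ⟨B, hB1, hB⟩ := o.bounds
  have ha := o.ha
  have hb := o.hb
  set d := c / (2 * a) with hd
  have hdpos : 0 < d := by positivity
  have hcd : c = 2 * a * d := by rw [hd]; field_simp
  -- `K₀` bounds increments of Wronskians
  set K₀ := 2 * B * K with hK₀
  set K₂ := K + B * (2 * K₀ / a) with hK₂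
  have hK₀n : 0 ≤ K₀ := by positivity
  have hK₂n : 0 ≤ K₂ := by positivity
  set Q := (a + b) * K₂ ^ 2 * (2 * π) with hQ
  have hQn : 0 ≤ Q := by positivity
  set G := 2 * (F * K) * (2 * π) with hG
  have hGn : 0 ≤ G := by positivity
  refine ⟨1 + Q / c + (d ^ 2 + G / a) / (2 * d), by positivity, ?_⟩
  intro r τ f x v hR hτ hs hfc hf hx0 hv0 hap hS h1 h2
  have hQc : 0 ≤ Q / c := by positivity
  have hGd : 0 ≤ (d ^ 2 + G / a) / (2 * d) := by positivity
  have hr : 0 < r := by linarith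
  have hQr : Q / r ≤ c := by
    rw [div_le_iff₀ hr]
    have : Q / c ≤ r := by linarith
    rw [div_le_iff₀ hc] at this; linarith
  have hGr : d ^ 2 + G / a ≤ 2 * d * r := by
    have : (d ^ 2 + G / a) / (2 * d) ≤ r := by linarith
    rw [div_le_iff₀ (by positivity)] at this; linarith
  -- energy
  have hE := o.energy hs hfc hf (fun t ht => (hap t ht).2)
  have e0 : v 0 ^ 2 + gg a b (x 0) * x 0 = a * r ^ 2 := by
    rw [hx0, hv0, gg_smul hr.le]; linear_combination r ^ 2 * o.en τ
  rw [e0] at hE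
  have hE' := (abs_le.1 hE).1
  have hE2 : a * (r + d) ^ 2 ≤ v (2 * π) ^ 2 + gg a b (x (2 * π)) * x (2 * π) := by
    have i1 : 2 * r * c ≤ 2 * r * ∫ t in (0:ℝ)..(2 * π), f t * S (t + τ) := by gcongr
    have i2 : a * (d ^ 2 + G / a) ≤ a * (2 * d * r) := by gcongr
    have i3 : a * (G / a) = G := by field_simp
    have i4 : 2 * r * c = 4 * a * d * r := by rw [hcd]; ring
    have i5 : a * (r + d) ^ 2 = a * r ^ 2 + a * (2 * d * r) + a * d ^ 2 := by ring
    have i6 : a * (d ^ 2 + G / a) = a * d ^ 2 + a * (G / a) := by ring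
    have i7 : a * (2 * d * r) = 2 * a * d * r := by ring
    linarith
  have hpos : 0 < a * (r + d) ^ 2 := by positivity
  -- the general bound on increments of W
  have hend := hap (2 * π) ⟨by positivity, le_refl _⟩
  rw [show 2 * π + τ = τ + 2 * π by ring, o.perC, o.perS, ← hx0, ← hv0] at hend
  have hinc : ∀ σ, |(x (2 * π) * S σ - v (2 * π) * C σ) - (x 0 * S σ - v 0 * C σ)| ≤ K₀ := by
    intro σ
    have : (x (2 * π) * S σ - v (2 * π) * C σ) - (x 0 * S σ - v 0 * C σ)
      = (x (2 * π) - x 0) * S σ - (v (2 * π) - v 0) * C σ := by ring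
    rw [this]
    refine (abs_sub _ _).trans ?_
    rw [abs_mul, abs_mul]
    have j1 : |x (2 * π) - x 0| * |S σ| ≤ K * B :=
      mul_le_mul hend.1 (hB σ).2 (abs_nonneg _) hK
    have j2 : |v (2 * π) - v 0| * |C σ| ≤ K * B :=
      mul_le_mul hend.2 (hB σ).1 (abs_nonneg _) hK
    rw [hK₀]; linarith
  -- closeness to the edge solution
  have hclose : ∀ σ, |τ - σ| * (a / 2) * r ≤ K₀ →
      ∀ t ∈ Set.Icc (0:ℝ) (2 * π), |x t - r * C (t + σ)| ≤ K₂ := by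
    intro σ hσ t ht
    have k1 := (hap t ht).1
    have k2 := o.lipC hB (t + σ) (t + τ)
    have k3 : r * |C (t + τ) - C (t + σ)| ≤ B * (2 * K₀ / a) := by
      have : t + τ - (t + σ) = τ - σ := by ring
      rw [this] at k2
      have k4 : r * |τ - σ| ≤ 2 * K₀ / a := by
        rw [le_div_iff₀ ha]
        calc r * |τ - σ| * a = 2 * (|τ - σ| * (a / 2) * r) := by ring
          _ ≤ 2 * K₀ := by gcongr
      calc r * |C (t + τ) - C (t + σ)| ≤ r * (B * |τ - σ|) := by gcongr
        _ = B * (r * |τ - σ|) := by ring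
        _ ≤ _ := by gcongr
    have k5 : x t - r * C (t + σ) = (x t - r * C (t + τ)) + r * (C (t + τ) - C (t + σ)) := by ring
    rw [k5]
    refine (abs_add_le _ _).trans ?_
    rw [abs_mul, abs_of_pos hr, hK₂]; linarith
  have hW : ∀ σ, |τ - σ| * (a / 2) * r ≤ K₀ →
    |(x (2 * π) * S σ - v (2 * π) * C σ) - (x 0 * S σ - v 0 * C σ)
      + ∫ t in (0:ℝ)..(2 * π), f t * C (t + σ)| ≤ c := by
    intro σ hσ
    have := o.wronskian hr hs hfc (hclose σ hσ)
    refine this.trans ?_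
    calc (a + b) * K₂ ^ 2 / r * (2 * π) = Q / r := by rw [hQ]; ring
      _ ≤ c := hQr
  have D1 := hw s₁ τ hτ.1 (by linarith [hτ.2])
  have D2 := hw τ s₂ hτ.2 (by linarith [hτ.1])
  have W1 : 0 ≤ x (2 * π) * S s₁ - v (2 * π) * C s₁ := by
    have h0 : x 0 * S s₁ - v 0 * C s₁ = r * (C τ * S s₁ - S τ * C s₁) := by
      rw [hx0, hv0]; ring
    have h0' : r * (a / 2 * (τ - s₁)) ≤ x 0 * S s₁ - v 0 * C s₁ := by rw [h0]; gcongr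
    have h00 : 0 ≤ r * (a / 2 * (τ - s₁)) := by have := hτ.1; have : 0 ≤ τ - s₁ := by linarith
                                                positivity
    rcases le_total (|τ - s₁| * (a / 2) * r) K₀ with h | h
    · have := (abs_le.1 (hW s₁ h)).1
      linarith
    · have := (abs_le.1 (hinc s₁)).1
      rw [abs_of_nonneg (by linarith [hτ.1])] at h
      have : r * (a / 2 * (τ - s₁)) = (τ - s₁) * (a / 2) * r := by ring
      linarith
  have W2 : x (2 * π) * S s₂ - v (2 * π) * C s₂ ≤ 0 := by
    have h0 : x 0 * S s₂ - v 0 * C s₂ = -(r * (C s₂ * S τ - S s₂ * C τ)) := by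
      rw [hx0, hv0]; ring
    have h0' : x 0 * S s₂ - v 0 * C s₂ ≤ -(r * (a / 2 * (s₂ - τ))) := by rw [h0]; gcongr
    have h00 : 0 ≤ r * (a / 2 * (s₂ - τ)) := by have := hτ.2; have : 0 ≤ s₂ - τ := by linarith
                                                positivity
    rcases le_total (|τ - s₂| * (a / 2) * r) K₀ with h | h
    · have := (abs_le.1 (hW s₂ h)).2
      linarith
    · have := (abs_le.1 (hinc s₂)).2
      rw [abs_of_nonpos (by linarith [hτ.2])] at h
      have : r * (a / 2 * (s₂ - τ)) = -(τ - s₂) * (a / 2) * r := by ring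
      linarith
  obtain ⟨r', hr', τ', hτ', hx', hv'⟩ := o.polar hw h12 h21 (lt_of_lt_of_le hpos hE2) W1 W2
  refine ⟨r', τ', ?_, hτ', hx', hv'⟩
  have e1 : v (2 * π) ^ 2 + gg a b (x (2 * π)) * x (2 * π) = a * r' ^ 2 := by
    rw [hx', hv', gg_smul hr'.le]; linear_combination r' ^ 2 * o.en τ'
  rw [e1] at hE2
  have : (r + d) ^ 2 ≤ r' ^ 2 := le_of_mul_le_mul_left hE2 ha
  exact (pow_le_pow_iff_left₀ (by positivity) hr'.le two_ne_zero).1 this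

end Osc

/-! ### The asymmetric cosine is an oscillator -/

lemma glue_at {f h₁ h₂ : ℝ → ℝ} {p q r d : ℝ} (hpq : p < q) (hqr : q < r)
    (h1 : ∀ t ∈ Set.Icc p q, f t = h₁ t) (h2 : ∀ t ∈ Set.Icc q r, f t = h₂ t)
    (d1 : HasDerivAt h₁ d q) (d2 : HasDerivAt h₂ d q) : HasDerivAt f d q := by
  have l : HasDerivWithinAt f d (Set.Iic q) q := by
    refine (d1.hasDerivWithinAt (s := Set.Iic q)).congr_of_eventuallyEq ?_
      (h1 q ⟨hpq.le, le_refl _⟩)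
    filter_upwards [self_mem_nhdsWithin, mem_nhdsWithin_of_mem_nhds (Ioi_mem_nhds hpq)] with t a b
    exact h1 t ⟨le_of_lt b, a⟩
  have r : HasDerivWithinAt f d (Set.Ici q) q := by
    refine (d2.hasDerivWithinAt (s := Set.Ici q)).congr_of_eventuallyEq ?_
      (h2 q ⟨le_refl _, hqr.le⟩)
    filter_upwards [self_mem_nhdsWithin, mem_nhdsWithin_of_mem_nhds (Iio_mem_nhds hqr)] with t a b
    exact h2 t ⟨a, le_of_lt b⟩
  have := l.union r
  rwa [Set.Iic_union_Ici, hasDerivWithinAt_univ] at this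

lemma glue_in {f h : ℝ → ℝ} {p q t d : ℝ} (ht : t ∈ Set.Ioo p q)
    (h1 : ∀ t ∈ Set.Icc p q, f t = h t) (d1 : HasDerivAt h d t) : HasDerivAt f d t := by
  refine d1.congr_of_eventuallyEq ?_
  filter_upwards [Ioo_mem_nhds ht.1 ht.2] with s hs
  exact h1 s (Set.Ioo_subset_Icc_self hs)

lemma glue {f f₁ f₂ f₁' f₂' : ℝ → ℝ} {δ T : ℝ} (hδ : 0 < δ) (hδT : δ < T - δ)
    (per : ∀ t, f (t + T) = f t) (h1 : ∀ t ∈ Set.Icc (-δ) δ, f t = f₁ t)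
    (h2 : ∀ t ∈ Set.Icc δ (T - δ), f t = f₂ t) (d1 : ∀ t, HasDerivAt f₁ (f₁' t) t)
    (d2 : ∀ t, HasDerivAt f₂ (f₂' t) t) (e1 : f₁' δ = f₂' δ) (e2 : f₁' (-δ) = f₂' (T - δ)) :
    (∀ t ∈ Set.Icc (-δ) δ, HasDerivAt f (f₁' t) t) ∧
    (∀ t ∈ Set.Icc δ (T - δ), HasDerivAt f (f₂' t) t) := by
  have hmid : HasDerivAt f (f₁' δ) δ :=
    glue_at (by linarith) hδT h1 h2 (d1 δ) (e1 ▸ d2 δ)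
  constructor
  · intro t ht
    rcases ht.1.eq_or_lt with h | h
    · subst h
      refine glue_at (p := δ - T) (r := δ) (h₁ := fun s => f₂ (s + T)) (by linarith) (by linarith)
        ?_ h1 ?_ (d1 _)
      · intro s hs
        rw [← per]; exact h2 _ ⟨by linarith [hs.1], by linarith [hs.2]⟩
      · apply HasDerivAt.comp_add_const
        rw [e2, show -δ + T = T - δ by ring]; exact d2 _
    · rcases ht.2.eq_or_lt with h' | h'
      · subst h'; exact hmid
      · exact glue_in ⟨h, h'⟩ h1 (d1 t)
  · intro t ht
    rcases ht.1.eq_or_lt with h | h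
    · subst h; rw [← e1]; exact hmid
    · rcases ht.2.eq_or_lt with h' | h'
      · subst h'
        refine glue_at (p := δ) (r := T + δ) (h₂ := fun s => f₁ (s - T)) (by linarith) (by linarith)
          h2 ?_ (d2 _) ?_
        · intro s hs
          have := per (s - T)
          rw [sub_add_cancel] at this
          rw [this]; exact h1 _ ⟨by linarith [hs.1], by linarith [hs.2]⟩
        · apply HasDerivAt.comp_sub_const
          rw [← e2, show T - δ - T = -δ by ring]; exact d1 _
      · exact glue_in ⟨h, h'⟩ h2 (d2 t)

/-- Everything needed about an asymmetric cosine; `T = 2π/n`, `δ = π/(2√a)`. -/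
structure Asym (a b T δ : ℝ) (C S : ℝ → ℝ) : Prop where
  osc : Osc a b T C S
  δpos : 0 < δ
  δlt : δ < T / 2
  even : ∀ t, C (-t) = C t
  pos : ∀ t ∈ Set.Ioo (-δ) δ, 0 < C t
  neg : ∀ t ∈ Set.Ioo δ (T - δ), C t < 0
  zero : C δ = 0
  Sneg : ∀ t ∈ Set.Ioo 0 (T / 2), S t < 0
  Sδ : S δ = -√a
  Sδ' : S (-δ) = √a

lemma exists_shift {T p : ℝ} (hT : 0 < T) (t : ℝ) : ∃ k : ℤ, t + k * T ∈ Set.Ico p (p + T) := by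
  obtain ⟨k, hk, -⟩ := existsUnique_add_zsmul_mem_Ico hT t p
  exact ⟨k, by simpa using hk⟩

lemma per_int {f : ℝ → ℝ} {T : ℝ} (per : ∀ t, f (t + T) = f t) (k : ℤ) (t : ℝ) :
    f (t + k * T) = f t := by
  have : Function.Periodic f T := per
  exact (this.int_mul k) t

lemma asym_of (n : ℕ) (hn : 1 ≤ n) {a b : ℝ} (ha : 0 < a) (hb : 0 < b)
    (hres : 1 / √a + 1 / √b = 2 / (n : ℝ)) {C : ℝ → ℝ} (hC : IsAsymCos n a b C) :
    ∃ S, Asym a b (2 * π / n) (π / (2 * √a)) C S := by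
  obtain ⟨hev, hper, hc1, hc2⟩ := hC
  have hn0 : (0:ℝ) < n := by exact_mod_cast hn
  have hsa : 0 < √a := Real.sqrt_pos.2 ha
  have hsb : 0 < √b := Real.sqrt_pos.2 hb
  have hsqa : √a ^ 2 = a := Real.sq_sqrt ha.le
  have hsqb : √b ^ 2 = b := Real.sq_sqrt hb.le
  have hpi := Real.pi_pos
  set T := 2 * π / n with hT
  set δ := π / (2 * √a) with hδ
  have hδpos : 0 < δ := by positivity
  have hTpos : 0 < T := by positivity
  have hTn : π / n = T / 2 := by rw [hT]; ring
  have haδ : √a * δ = π / 2 := by rw [hδ]; field_simp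
  have hsum : T = 2 * δ + π / √b := by
    have : T = π * (2 / (n:ℝ)) := by rw [hT]; ring
    rw [this, ← hres, hδ]; field_simp
  have hb' : √b * (T - 2 * δ) = π := by rw [hsum]; field_simp; ring
  have hδ' : 0 < T - 2 * δ := by
    by_contra h; push Not at h; nlinarith
  have hq : √(a / b) = √a / √b := Real.sqrt_div ha.le b
  rw [hTn] at hc2
  have h1 : ∀ t ∈ Set.Icc (-δ) δ, C t = Real.cos (√a * t) := by
    intro t ht
    rcases le_total 0 t with h | h
    · exact hc1 t ⟨h, ht.2⟩
    · rw [← hev, hc1 (-t) ⟨by linarith, by linarith [ht.1]⟩]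
      rw [mul_neg, Real.cos_neg]
  have h2 : ∀ t ∈ Set.Icc δ (T - δ), C t = -(√a / √b) * Real.sin (√b * (t - δ)) := by
    intro t ht
    rw [← hq]
    rcases le_total t (T / 2) with h | h
    · exact hc2 t ⟨ht.1, h⟩
    · have e : C t = C (T - t) := by
        rw [← hev, ← hper]; congr 1; ring
      rw [e, hc2 (T - t) ⟨by linarith [ht.2], by linarith⟩]
      have : √b * (T - t - δ) = π - √b * (t - δ) := by rw [← hb']; ring
      rw [this, Real.sin_pi_sub]
  have g1 : ∀ t, HasDerivAt (fun t => Real.cos (√a * t)) (-√a * Real.sin (√a * t)) t := by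
    intro t
    exact ((hasDerivAt_id' t).const_mul (√a)).cos.congr_deriv (by ring)
  have g1' : ∀ t, HasDerivAt (fun t => -√a * Real.sin (√a * t)) (-a * Real.cos (√a * t)) t := by
    intro t
    exact (((hasDerivAt_id' t).const_mul (√a)).sin.const_mul (-√a)).congr_deriv
      (by linear_combination (-Real.cos (√a * t)) * hsqa)
  have g2 : ∀ t, HasDerivAt (fun t => -(√a / √b) * Real.sin (√b * (t - δ)))
      (-√a * Real.cos (√b * (t - δ))) t := by
    intro t
    exact (((((hasDerivAt_id' t).sub_const δ).const_mul (√b)).sin).const_mul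
      (-(√a / √b))).congr_deriv (by field_simp)
  have g2' : ∀ t, HasDerivAt (fun t => -√a * Real.cos (√b * (t - δ)))
      (√a * √b * Real.sin (√b * (t - δ))) t := by
    intro t
    exact (((((hasDerivAt_id' t).sub_const δ).const_mul (√b)).cos).const_mul
      (-√a)).congr_deriv (by ring)
  have hTδ : √b * (T - δ - δ) = π := by rw [← hb']; ring
  obtain ⟨A, B⟩ := glue hδpos (by linarith) hper h1 h2 g1 g2
    (by simp [haδ]) (by simp [haδ, hTδ])
  have hSper : ∀ t, deriv C (t + T) = deriv C t := by
    intro t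
    rw [← deriv_comp_add_const]; congr 1; funext s; exact hper s
  obtain ⟨A', B'⟩ := glue hδpos (by linarith) hSper (fun t ht => (A t ht).deriv)
    (fun t ht => (B t ht).deriv) g1' g2' (by simp [haδ]) (by simp [haδ, hTδ])
  have Cnn : ∀ t ∈ Set.Icc (-δ) δ, 0 ≤ C t := by
    intro t ht
    rw [h1 t ht]
    apply Real.cos_nonneg_of_neg_pi_div_two_le_of_le
    · rw [← haδ]; nlinarith [ht.1]
    · rw [← haδ]; nlinarith [ht.2]
  have Cnp : ∀ t ∈ Set.Icc δ (T - δ), C t ≤ 0 := by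
    intro t ht
    rw [h2 t ht, neg_mul, neg_nonpos]
    apply mul_nonneg (by positivity)
    apply Real.sin_nonneg_of_nonneg_of_le_pi
    · have : 0 ≤ t - δ := by linarith [ht.1]
      positivity
    · rw [← hTδ]; gcongr; exact ht.2
  have ddC : ∀ t, HasDerivAt C (deriv C t) t := by
    intro t
    obtain ⟨k, hk⟩ := exists_shift (p := -δ) hTpos t
    have key : HasDerivAt C (deriv C (t + k * T)) (t + k * T) := by
      rcases le_total (t + k * T) δ with h | h
      · exact (A _ ⟨hk.1, h⟩).differentiableAt.hasDerivAt
      · exact (B _ ⟨h, by linarith [hk.2]⟩).differentiableAt.hasDerivAt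
    have := key.comp_add_const t (k * T)
    rw [per_int hSper] at this
    exact this.congr_of_eventuallyEq (Eventually.of_forall fun s => (per_int hper k s).symm)
  have ddS : ∀ t, HasDerivAt (deriv C) (-(gg a b (C t))) t := by
    intro t
    obtain ⟨k, hk⟩ := exists_shift (p := -δ) hTpos t
    have key : HasDerivAt (deriv C) (-(gg a b (C (t + k * T)))) (t + k * T) := by
      rcases le_total (t + k * T) δ with h | h
      · have m : t + k * T ∈ Set.Icc (-δ) δ := ⟨hk.1, h⟩
        refine (A' _ m).congr_deriv ?_
        rw [gg_nonneg_arg (Cnn _ m), h1 _ m]; ring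
      · have m : t + k * T ∈ Set.Icc δ (T - δ) := ⟨h, by linarith [hk.2]⟩
        refine (B' _ m).congr_deriv ?_
        rw [gg_nonpos_arg (Cnp _ m), h2 _ m]
        field_simp; linear_combination Real.sin (√b * (t + k * T - δ)) * hsqb
    have := key.comp_add_const t (k * T)
    rw [per_int hper] at this
    exact this.congr_of_eventuallyEq (Eventually.of_forall fun s => (per_int hSper k s).symm)
  have hC0 : C 0 = 1 := by rw [h1 0 ⟨by linarith, hδpos.le⟩]; simp
  have hS0 : deriv C 0 = 0 := by rw [(A 0 ⟨by linarith, hδpos.le⟩).deriv]; simp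
  have den : ∀ t, HasDerivAt (fun t => deriv C t ^ 2 + gg a b (C t) * C t) 0 t := by
    intro t
    have e := (hasDerivAt_gg_mul a b (C t)).comp t (ddC t)
    exact (((ddS t).pow 2).add e).congr_deriv (by push_cast; ring)
  have hen : ∀ t, deriv C t ^ 2 + gg a b (C t) * C t = a := by
    intro t
    have := is_const_of_deriv_eq_zero (fun t => (den t).differentiableAt)
      (fun t => (den t).deriv) t 0
    rw [this, hC0, hS0, gg_nonneg_arg zero_le_one]; ring
  refine ⟨deriv C, ⟨⟨ha, hb, ddC, ddS, hper, hSper, hen⟩, hδpos, by linarith, hev, ?_, ?_, ?_, ?_, ?_, ?_⟩⟩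
  · intro t ht
    rw [h1 t (Set.Ioo_subset_Icc_self ht)]
    apply Real.cos_pos_of_mem_Ioo
    constructor
    · rw [← haδ]; nlinarith [ht.1]
    · rw [← haδ]; nlinarith [ht.2]
  · intro t ht
    rw [h2 t (Set.Ioo_subset_Icc_self ht), neg_mul, neg_lt_zero]
    apply mul_pos (by positivity)
    apply Real.sin_pos_of_pos_of_lt_pi
    · have : 0 < t - δ := by linarith [ht.1]
      positivity
    · rw [← hTδ]; gcongr; exact ht.2
  · rw [h1 δ ⟨by linarith, le_refl _⟩, haδ, Real.cos_pi_div_two]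
  · intro t ht
    rcases le_total t δ with h | h
    · rw [(A t ⟨by linarith [ht.1], h⟩).deriv, neg_mul, neg_lt_zero]
      apply mul_pos hsa
      apply Real.sin_pos_of_pos_of_lt_pi (mul_pos hsa ht.1)
      have : √a * t ≤ √a * δ := by gcongr
      linarith
    · rw [(B t ⟨h, by linarith [ht.2]⟩).deriv, neg_mul, neg_lt_zero]
      apply mul_pos hsa
      apply Real.cos_pos_of_mem_Ioo
      have : 0 ≤ √b * (t - δ) := mul_nonneg hsb.le (by linarith)
      constructor
      · linarith
      · have : √b * (t - δ) < √b * (T / 2 - δ) := by gcongr; exact ht.2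
        have : √b * (T / 2 - δ) = π / 2 := by rw [← hb']; ring
        linarith
  · rw [(A δ ⟨by linarith, le_refl _⟩).deriv, haδ]; simp
  · rw [(A (-δ) ⟨le_refl _, by linarith⟩).deriv, mul_neg, haδ]; simp

/-! ### Averaging -/

def sg (c : ℝ) : ℝ := if 0 < c then 1 else -1

lemma sg_abs (c : ℝ) : |sg c| = 1 := by unfold sg; split_ifs <;> simp

lemma sg_meas : Measurable sg :=
  Measurable.ite (measurableSet_lt measurable_const measurable_id) measurable_const measurable_const

lemma sg_ii {C ψ : ℝ → ℝ} (hC : Continuous C) (hψ : Continuous ψ) (p q : ℝ) :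
    IntervalIntegrable (fun t => sg (C t) * ψ t) volume p q := by
  refine (hψ.intervalIntegrable p q).mono_fun ?_ ?_
  · exact ((sg_meas.comp hC.measurable).mul hψ.measurable).aestronglyMeasurable
  · refine Eventually.of_forall fun t => ?_
    simp [abs_mul, sg_abs]

namespace Asym
variable {a b T δ : ℝ} {C S : ℝ → ℝ}

lemma Tpos (A : Asym a b T δ C S) : 0 < T := by have := A.δpos; have := A.δlt; linarith

lemma null (A : Asym a b T δ C S) : ∀ᵐ t : ℝ, C t ≠ 0 := by
  have hc : (⋃ k : ℤ, ({-δ - k * T, δ - k * T} : Set ℝ)).Countable :=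
    Set.countable_iUnion fun k => (Set.toFinite _).countable
  have : {t : ℝ | ¬ C t ≠ 0} ⊆ ⋃ k : ℤ, ({-δ - k * T, δ - k * T} : Set ℝ) := by
    intro t ht
    simp only [ne_eq, not_not, Set.mem_ofPred_eq] at ht
    obtain ⟨k, hk⟩ := exists_shift (p := -δ) A.Tpos t
    rw [← per_int A.osc.perC k] at ht
    refine Set.mem_iUnion.2 ⟨k, ?_⟩
    rcases hk.1.eq_or_lt with h | h
    · left; linarith
    rcases lt_trichotomy (t + k * T) δ with h' | h' | h'
    · exact absurd ht (A.pos _ ⟨h, h'⟩).ne'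
    · right; show t = _; linarith
    · exact absurd ht (A.neg _ ⟨h', by linarith [hk.2]⟩).ne
  exact measure_mono_null this (hc.measure_zero _)

lemma tent (A : Asym a b T δ C S) :
    Tendsto (fun m : ℕ => ∫ t in (0:ℝ)..(2 * π), max 0 (2 - m * |C t|)) atTop (nhds 0) := by
  have cC := A.osc.contC
  have := intervalIntegral.tendsto_integral_filter_of_dominated_convergence (μ := volume)
    (a := 0) (b := 2 * π) (l := atTop) (F := fun (m : ℕ) t => max 0 (2 - m * |C t|))
    (f := fun _ => (0:ℝ)) (fun _ => 2)
    (Eventually.of_forall fun m => by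
      apply Continuous.aestronglyMeasurable; fun_prop)
    (Eventually.of_forall fun m => Eventually.of_forall fun t _ => by
      rw [Real.norm_of_nonneg (le_max_left _ _)]
      refine max_le (by norm_num) ?_
      have : 0 ≤ (m:ℝ) * |C t| := by positivity
      linarith)
    intervalIntegrable_const
    (by
      filter_upwards [A.null] with t ht _
      have hp : 0 < |C t| := abs_pos.2 ht
      obtain ⟨N, hN⟩ := exists_nat_gt (2 / |C t|)
      refine tendsto_const_nhds.congr' ?_
      filter_upwards [eventually_ge_atTop N] with m hm
      symm
      apply max_eq_left
      rw [div_lt_iff₀ hp] at hN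
      have : (N:ℝ) * |C t| ≤ m * |C t| := by gcongr
      linarith)
  simpa using this

/-- Replacing `φ(y)` by its limiting values in integrals. -/
lemma phi_approx (A : Asym a b T δ C S) (per : ∀ t, C (t + 2 * π) = C t)
    {φ : ℝ → ℝ} {M l : ℝ} (hφ : Continuous φ) (hM : ∀ x, |φ x| ≤ M)
    (htop : Tendsto φ atTop (nhds l)) (hbot : Tendsto φ atBot (nhds (-l)))
    {K B ε : ℝ} (hK : 0 ≤ K) (hB : 0 ≤ B) (hε : 0 < ε) :
    ∃ R > 0, ∀ (r τ : ℝ) (y ψ : ℝ → ℝ), R ≤ r → ContinuousOn y (Set.Icc 0 (2 * π)) →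
      (∀ t ∈ Set.Icc (0:ℝ) (2 * π), |y t - r * C (t + τ)| ≤ K) → Continuous ψ →
      (∀ t, |ψ t| ≤ B) →
      |(∫ t in (0:ℝ)..(2 * π), φ (y t) * ψ t)
        - l * ∫ t in (0:ℝ)..(2 * π), sg (C (t + τ)) * ψ t| ≤ ε := by
  have cC := A.osc.contC
  have hM0 : 0 ≤ M := (abs_nonneg _).trans (hM 0)
  have hl : |l| ≤ M := le_of_tendsto (htop.abs) (Eventually.of_forall hM)
  have hpi := Real.pi_pos
  -- a small pointwise error
  obtain ⟨e, he, hee⟩ : ∃ e > 0, e * (2 * π) * B ≤ ε / 2 := by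
    refine ⟨ε / 2 / (2 * π * (B + 1)), by positivity, ?_⟩
    have : ε / 2 / (2 * π * (B + 1)) * (2 * π) * B = ε / 2 * (B / (B + 1)) := by field_simp
    rw [this]
    have : B / (B + 1) ≤ 1 := by rw [div_le_one (by linarith)]; linarith
    nlinarith
  obtain ⟨Y, hY0, hY1, hY2⟩ : ∃ Y > 0, (∀ x ≥ Y, |φ x - l| ≤ e) ∧ (∀ x ≤ -Y, |φ x + l| ≤ e) := by
    have h1 := htop (Metric.closedBall_mem_nhds l he)
    have h2 := hbot (Metric.closedBall_mem_nhds (-l) he)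
    obtain ⟨Y1, h1⟩ := mem_atTop_sets.1 h1
    obtain ⟨Y2, h2⟩ := mem_atBot_sets.1 h2
    refine ⟨1 + |Y1| + |Y2|, by positivity, fun x hx => ?_, fun x hx => ?_⟩
    · have := h1 x (by have := le_abs_self Y1; have := abs_nonneg Y2; linarith)
      simpa [Real.dist_eq] using this
    · have := h2 x (by have := neg_abs_le Y2; have := abs_nonneg Y1; linarith)
      simpa [Real.dist_eq] using this
  -- tent with small integral
  obtain ⟨m, hm1, hm⟩ : ∃ m : ℕ, 1 ≤ m ∧
      2 * M * (∫ t in (0:ℝ)..(2 * π), max 0 (2 - m * |C t|)) * B ≤ ε / 2 := by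
    have h1 : Tendsto (fun m : ℕ => 2 * M * (∫ t in (0:ℝ)..(2 * π), max 0 (2 - m * |C t|)) * B)
        atTop (nhds (2 * M * 0 * B)) := (A.tent.const_mul (2 * M)).mul_const B
    rw [mul_zero, zero_mul] at h1
    have h2 := h1.eventually_lt_const (half_pos hε)
    obtain ⟨m, h3, h4⟩ := (h2.and (eventually_ge_atTop 1)).exists
    exact ⟨m, h4, h3.le⟩
  have hm0 : (0:ℝ) < m := by exact_mod_cast hm1
  refine ⟨m * (Y + K), by positivity, ?_⟩
  intro r τ y ψ hr hy hyK hψ hψB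
  have hr0 : 0 < r := lt_of_lt_of_le (by positivity) hr
  have hpt : ∀ t ∈ Set.Icc (0:ℝ) (2 * π), |φ (y t) - l * sg (C (t + τ))| ≤
      e + 2 * M * max 0 (2 - m * |C (t + τ)|) := by
    intro t ht
    have hk := abs_le.1 (hyK t ht)
    have hnn : 0 ≤ 2 * M * max 0 (2 - m * |C (t + τ)|) :=
      mul_nonneg (by linarith) (le_max_left _ _)
    rcases le_total 1 (m * |C (t + τ)|) with h | h
    · have hbig : Y + K ≤ r * |C (t + τ)| := by
        calc Y + K = 1 * (Y + K) := by ring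
          _ ≤ (m * |C (t + τ)|) * (Y + K) := by gcongr
          _ = (m * (Y + K)) * |C (t + τ)| := by ring
          _ ≤ _ := by gcongr
      rcases lt_or_ge 0 (C (t + τ)) with hs | hs
      · rw [abs_of_pos hs] at hbig
        have := hY1 (y t) (by linarith)
        simp only [sg, hs, if_true, mul_one]
        linarith
      · rw [abs_of_nonpos hs] at hbig
        have := hY2 (y t) (by linarith)
        simp only [sg, not_lt.2 hs, if_false, mul_neg, mul_one, sub_neg_eq_add]
        linarith
    · have h1 : |φ (y t) - l * sg (C (t + τ))| ≤ 2 * M := by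
        refine (abs_sub _ _).trans ?_
        rw [abs_mul, sg_abs, mul_one]
        linarith [hM (y t)]
      have h2 : 1 ≤ max 0 (2 - m * |C (t + τ)|) := le_max_of_le_right (by linarith)
      nlinarith
  have i1 : IntervalIntegrable (fun t => φ (y t) * ψ t) volume 0 (2 * π) := by
    apply Osc.ii_of_cont
    exact (hφ.comp_continuousOn hy).mul hψ.continuousOn
  have i2 : IntervalIntegrable (fun t => l * (sg (C (t + τ)) * ψ t)) volume 0 (2 * π) :=
    (sg_ii (C := fun t => C (t + τ)) (by fun_prop) hψ _ _).const_mul l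
  rw [← intervalIntegral.integral_const_mul, ← intervalIntegral.integral_sub i1 i2]
  have hshift : (∫ t in (0:ℝ)..(2 * π), max 0 (2 - m * |C (t + τ)|))
      = ∫ t in (0:ℝ)..(2 * π), max 0 (2 - m * |C t|) := by
    rw [intervalIntegral.integral_comp_add_right (fun t => max 0 (2 - m * |C t|)) τ]
    have hp : Function.Periodic (fun t => max 0 (2 - m * |C t|)) (2 * π) := by
      intro t; simp only [per]
    have := hp.intervalIntegral_add_eq τ 0
    rw [zero_add] at this
    rw [zero_add, add_comm (2 * π) τ]; exact this
  have i3 : IntervalIntegrable (fun t => max 0 (2 - m * |C (t + τ)|)) volume 0 (2 * π) := by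
    apply Continuous.intervalIntegrable; fun_prop
  calc |∫ t in (0:ℝ)..(2 * π), (φ (y t) * ψ t - l * (sg (C (t + τ)) * ψ t))|
      ≤ |∫ t in (0:ℝ)..(2 * π), (e + 2 * M * max 0 (2 - m * |C (t + τ)|)) * B| := by
        have := intervalIntegral.norm_integral_le_abs_of_norm_le (μ := volume) (a := 0) (b := 2 * π)
          (f := fun t => φ (y t) * ψ t - l * (sg (C (t + τ)) * ψ t))
          (g := fun t => (e + 2 * M * max 0 (2 - m * |C (t + τ)|)) * B) ?_ ?_
        · exact this
        · refine (ae_restrict_iff' measurableSet_uIoc).2 (Eventually.of_forall fun t ht => ?_)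
          have ht' : t ∈ Set.Icc (0:ℝ) (2 * π) := by
            rw [← Osc.twopi_uIcc]; exact Set.uIoc_subset_uIcc ht
          rw [show φ (y t) * ψ t - l * (sg (C (t + τ)) * ψ t)
            = (φ (y t) - l * sg (C (t + τ))) * ψ t by ring, norm_mul]
          exact mul_le_mul (hpt t ht') (hψB t) (abs_nonneg _) ((abs_nonneg _).trans (hpt t ht'))
        · apply Continuous.intervalIntegrable; fun_prop
    _ = |e * (2 * π) * B + 2 * M * (∫ t in (0:ℝ)..(2 * π), max 0 (2 - m * |C t|)) * B| := by
        rw [intervalIntegral.integral_mul_const, intervalIntegral.integral_add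
          intervalIntegrable_const (i3.const_mul _), intervalIntegral.integral_const_mul, hshift]
        congr 1; simp; ring
    _ ≤ ε := by
        rw [abs_of_nonneg]
        · linarith
        · have : 0 ≤ ∫ t in (0:ℝ)..(2 * π), max 0 (2 - m * |C t|) :=
            intervalIntegral.integral_nonneg (by positivity) fun t _ => le_max_left _ _
          positivity

/-- The averaged value. -/
lemma sg_int (A : Asym a b T δ C S) {n : ℕ} (hT : n * T = 2 * π) {Q : ℝ → ℝ} (cQ : Continuous Q)
    (perQ : ∀ t, Q (t + T) = Q t) (τ₁ τ₂ : ℝ) :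
    ∫ t in (0:ℝ)..(2 * π), sg (C (t + τ₂)) * Q (t + τ₁)
      = n * (2 * (∫ t in (τ₁ - τ₂ - δ)..(τ₁ - τ₂ + δ), Q t) - ∫ t in (-δ)..(T - δ), Q t) := by
  have cC := A.osc.contC
  have hδ := A.δpos
  have hδ' := A.δlt
  set ω := τ₁ - τ₂ with hω
  have cQ' : Continuous fun t => Q (t + ω) := by fun_prop
  have e1 : ∀ t, sg (C (t + τ₂)) * Q (t + τ₁) = (fun s => sg (C s) * Q (s + ω)) (t + τ₂) := by
    intro t; simp only; congr 2; rw [hω]; ring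
  simp_rw [e1]
  rw [intervalIntegral.integral_comp_add_right (fun s => sg (C s) * Q (s + ω)) τ₂]
  have hp : Function.Periodic (fun s => sg (C s) * Q (s + ω)) T := by
    intro s; simp only [A.osc.perC]
    rw [show s + T + ω = s + ω + T by ring, perQ]
  have h1 := hp.intervalIntegral_add_zsmul_eq n τ₂ (sg_ii cC cQ')
  have h2 : (0:ℝ) + τ₂ = τ₂ := zero_add _
  have h3 : 2 * π + τ₂ = τ₂ + (n : ℤ) • T := by rw [← hT]; simp; ring
  rw [h2, h3, h1, hp.intervalIntegral_add_eq τ₂ (-δ)]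
  have h4 : -δ + T = T - δ := by ring
  rw [h4, ← intervalIntegral.integral_add_adjacent_intervals (sg_ii cC cQ' (-δ) δ)
    (sg_ii cC cQ' δ (T - δ))]
  have h5 : ∫ s in (-δ)..δ, sg (C s) * Q (s + ω) = ∫ s in (-δ)..δ, Q (s + ω) := by
    apply intervalIntegral.integral_congr_Ioo_of_le (by linarith)
    intro s hs; simp [sg, A.pos s hs]
  have h6 : ∫ s in δ..(T - δ), sg (C s) * Q (s + ω) = ∫ s in δ..(T - δ), -Q (s + ω) := by
    apply intervalIntegral.integral_congr_Ioo_of_le (by linarith)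
    intro s hs; simp [sg, (A.neg s hs).le]
  have h7 : (∫ s in (-δ)..δ, Q (s + ω)) + (∫ s in δ..(T - δ), Q (s + ω))
      = ∫ s in (-δ)..(T - δ), Q (s + ω) := intervalIntegral.integral_add_adjacent_intervals
        (cQ'.intervalIntegrable _ _) (cQ'.intervalIntegrable _ _)
  have h8 : (∫ s in (-δ)..(T - δ), Q (s + ω)) = ∫ s in (-δ)..(T - δ), Q s := by
    rw [intervalIntegral.integral_comp_add_right]
    have hQ : Function.Periodic Q T := perQ
    have := hQ.intervalIntegral_add_eq (-δ + ω) (-δ)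
    rw [h4] at this
    rw [← this]; congr 1; ring
  have h9 : (∫ s in (-δ)..δ, Q (s + ω)) = ∫ t in (ω - δ)..(ω + δ), Q t := by
    rw [intervalIntegral.integral_comp_add_right]; congr 1 <;> ring
  rw [h5, h6, intervalIntegral.integral_neg, ← h9, ← h8, ← h7]
  simp; ring

/-- The mean of the asymmetric cosine. -/
lemma int_C (A : Asym a b T δ C S) : ∫ t in (-δ)..(T - δ), C t = 2 * (1 / √a - √a / b) := by
  have cC := A.osc.contC
  have cS := A.osc.contS
  have ha := A.osc.ha
  have hb := A.osc.hb
  have hδ := A.δpos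
  have hδ' := A.δlt
  have cg : Continuous fun t => -(gg a b (C t)) := ((gg_continuous a b).comp cC).neg
  have h1 : ∫ t in (-δ)..δ, -(gg a b (C t)) = S δ - S (-δ) :=
    intervalIntegral.integral_eq_sub_of_hasDerivAt (fun t _ => A.osc.dS t)
      (cg.intervalIntegrable _ _)
  have h2 : ∫ t in δ..(T - δ), -(gg a b (C t)) = S (T - δ) - S δ :=
    intervalIntegral.integral_eq_sub_of_hasDerivAt (fun t _ => A.osc.dS t)
      (cg.intervalIntegrable _ _)
  have h3 : ∫ t in (-δ)..δ, -(gg a b (C t)) = ∫ t in (-δ)..δ, (-a) * C t := by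
    apply intervalIntegral.integral_congr_Ioo_of_le (by linarith)
    intro s hs; simp only; rw [gg_nonneg_arg (A.pos s hs).le]; ring
  have h4 : ∫ t in δ..(T - δ), -(gg a b (C t)) = ∫ t in δ..(T - δ), (-b) * C t := by
    apply intervalIntegral.integral_congr_Ioo_of_le (by linarith)
    intro s hs; simp only; rw [gg_nonpos_arg (A.neg s hs).le]; ring
  have h5 : S (T - δ) = √a := by
    rw [← A.Sδ', ← A.osc.perS (-δ)]; congr 1; ring
  rw [h3, intervalIntegral.integral_const_mul, A.Sδ, A.Sδ'] at h1
  rw [h4, intervalIntegral.integral_const_mul, A.Sδ, h5] at h2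
  rw [← intervalIntegral.integral_add_adjacent_intervals (cC.intervalIntegrable (-δ) δ)
    (cC.intervalIntegrable δ (T - δ))]
  have hs : 0 < √a := Real.sqrt_pos.2 ha
  have hsq : √a ^ 2 = a := Real.sq_sqrt ha.le
  have e1 : ∫ t in (-δ)..δ, C t = 2 / √a := by
    rw [eq_div_iff hs.ne']
    apply mul_left_cancel₀ ha.ne'
    linear_combination (-√a) * h1 + 2 * hsq
  have e2 : ∫ t in δ..(T - δ), C t = - (2 * √a / b) := by
    rw [eq_neg_iff_add_eq_zero]; field_simp; linear_combination - h2
  rw [e1, e2]; ring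

end Asym

/-- Differentiating the correlation integral. -/
lemma Osc.corr_deriv {a b T : ℝ} {C S q : ℝ → ℝ} (o : Osc a b T C S) (hq : Continuous q) (σ : ℝ) :
    HasDerivAt (fun σ => ∫ t in (0:ℝ)..(2 * π), q t * C (t + σ))
      (∫ t in (0:ℝ)..(2 * π), q t * S (t + σ)) σ := by
  obtain ⟨B, hB1, hB⟩ := o.bounds
  have cC := o.contC
  have cS := o.contS
  refine (intervalIntegral.hasDerivAt_integral_of_dominated_loc_of_deriv_le (μ := volume)
    (F := fun σ t => q t * C (t + σ)) (F' := fun σ t => q t * S (t + σ)) (s := Set.univ)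
    (bound := fun t => |q t| * B) Filter.univ_mem
    (Eventually.of_forall fun s => by apply Continuous.aestronglyMeasurable; fun_prop)
    (by apply Continuous.intervalIntegrable; fun_prop)
    (by apply Continuous.aestronglyMeasurable; fun_prop)
    (Eventually.of_forall fun t _ s _ => ?_)
    (by apply Continuous.intervalIntegrable; fun_prop)
    (Eventually.of_forall fun t _ s _ => ?_)).2
  · rw [norm_mul]; exact mul_le_mul_of_nonneg_left (hB _).2 (abs_nonneg _)
  · exact ((o.dC (t + s)).comp_const_add t s).const_mul (q t)

/-- The resonant Fourier coefficient. -/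
lemma fourier_corr {C : ℝ → ℝ} (cC : Continuous C) (hev : ∀ t, C (-t) = C t)
    (per : ∀ t, C (t + 2 * π) = C t) (N : ℕ) (σ : ℝ) :
    ∫ t in (0:ℝ)..(2 * π), Real.cos (N * t) * C (t + σ)
      = Real.cos (N * σ) * ∫ t in (0:ℝ)..(2 * π), C t * Real.cos (N * t) := by
  have hcos : ∀ t, Real.cos (N * (t + 2 * π)) = Real.cos (N * t) := by
    intro t
    rw [mul_add]; exact Real.cos_add_nat_mul_two_pi _ N
  have hsin : ∀ t, Real.sin (N * (t + 2 * π)) = Real.sin (N * t) := by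
    intro t
    rw [mul_add]; exact Real.sin_add_nat_mul_two_pi _ N
  let h : ℝ → ℝ := fun s => Real.cos (N * (s - σ)) * C s
  have e1 : ∀ t, Real.cos (N * t) * C (t + σ) = h (t + σ) := by
    intro t; simp [h]
  simp_rw [e1]
  rw [intervalIntegral.integral_comp_add_right h σ]
  have hp : Function.Periodic h (2 * π) := by
    intro s; simp only [h, per]
    rw [show s + 2 * π - σ = s - σ + 2 * π by ring, hcos]
  have hp2 : Function.Periodic (fun t => C t * Real.cos (N * t)) (2 * π) := by
    intro s; simp only [per, hcos]
  have h1 := hp.intervalIntegral_add_eq σ (-π)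
  have h2 := hp2.intervalIntegral_add_eq 0 (-π)
  rw [show -π + 2 * π = π by ring] at h1 h2
  rw [zero_add] at h2
  rw [zero_add, add_comm (2 * π) σ, h1, h2]
  have e2 : ∀ s, h s = Real.cos (N * σ) * (C s * Real.cos (N * s))
      + Real.sin (N * σ) * (C s * Real.sin (N * s)) := by
    intro s; simp only [h]; rw [mul_sub, Real.cos_sub]; ring
  simp_rw [e2]
  rw [intervalIntegral.integral_add (by apply Continuous.intervalIntegrable; fun_prop)
    (by apply Continuous.intervalIntegrable; fun_prop), intervalIntegral.integral_const_mul,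
    intervalIntegral.integral_const_mul]
  have e3 : ∫ s in (-π)..π, C s * Real.sin (N * s) = 0 := by
    have := intervalIntegral.integral_comp_neg (a := -π) (b := π) (fun s => C s * Real.sin (N * s))
    simp only [hev, mul_neg, Real.sin_neg, neg_neg, intervalIntegral.integral_neg] at this
    linarith
  rw [e3]; ring

/-! ### The phase box for the first oscillator -/

lemma Asym.antiC {a b T δ : ℝ} {C S : ℝ → ℝ} (A : Asym a b T δ C S) {x y : ℝ} (hx : 0 ≤ x)
    (hxy : x < y) (hy : y ≤ T / 2) : C y < C x := by
  have h : StrictAntiOn C (Set.Icc 0 (T / 2)) := by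
    refine strictAntiOn_of_deriv_neg (convex_Icc _ _) A.osc.contC.continuousOn ?_
    intro t ht
    rw [interior_Icc] at ht
    rw [(A.osc.dC t).deriv]
    exact A.Sneg t ht
  exact h ⟨hx, by linarith⟩ ⟨by linarith, hy⟩ hxy

lemma Asym.diff_neg {a b T δ₁ δ : ℝ} {C S : ℝ → ℝ} (A : Asym a b T δ₁ C S) (hδ : 0 < δ)
    (hδT : δ < T / 2) {s : ℝ} (hs0 : 0 < s) (hsT : s < T / 2) : C (s + δ) < C (s - δ) := by
  have e1 : C (s - δ) = C |s - δ| := by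
    rcases abs_cases (s - δ) with ⟨h, -⟩ | ⟨h, -⟩ <;> rw [h]
    rw [A.even]
  rw [e1]
  by_cases h : s + δ ≤ T / 2
  · apply A.antiC (abs_nonneg _) _ h
    rw [abs_lt]; constructor <;> linarith
  · have e2 : C (s + δ) = C (T - (s + δ)) := by
      rw [← A.even (s + δ), ← A.osc.perC]; congr 1; ring
    rw [e2]
    apply A.antiC (abs_nonneg _) _ (by linarith)
    rw [abs_lt]; constructor <;> linarith

lemma L_deriv {C : ℝ → ℝ} (cC : Continuous C) (δ s : ℝ) :
    HasDerivAt (fun s => ∫ t in (s - δ)..(s + δ), C t) (C (s + δ) - C (s - δ)) s := by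
  have e : (fun s => ∫ t in (s - δ)..(s + δ), C t)
      = fun s => (∫ t in (0:ℝ)..(s + δ), C t) - ∫ t in (0:ℝ)..(s - δ), C t := by
    funext s
    rw [intervalIntegral.integral_interval_sub_left] <;> exact cC.intervalIntegrable _ _
  rw [e]
  have h : ∀ u, HasDerivAt (fun u => ∫ t in (0:ℝ)..u, C t) (C u) u := fun u =>
    intervalIntegral.integral_hasDerivAt_right (cC.intervalIntegrable _ _)
      (cC.stronglyMeasurableAtFilter _ _) cC.continuousAt
  have h1 := (h (s + δ)).comp s ((hasDerivAt_id s).add_const δ)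
  have h2 := (h (s - δ)).comp s ((hasDerivAt_id s).sub_const δ)
  refine (h1.sub h2).congr_deriv ?_
  simp

lemma L_even {C : ℝ → ℝ} (ev : ∀ t, C (-t) = C t) (δ s : ℝ) :
    ∫ t in (-s - δ)..(-s + δ), C t = ∫ t in (s - δ)..(s + δ), C t := by
  have := intervalIntegral.integral_comp_neg (a := s - δ) (b := s + δ) C
  simp only [ev] at this
  rw [this]; congr 1 <;> ring

lemma Asym.exists_omega {a b T δ₁ δ α l : ℝ} {C S : ℝ → ℝ} (A : Asym a b T δ₁ C S) (hδ : 0 < δ)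
    (hδT : δ < T / 2) (h0 : α < ∫ t in (0 - δ)..(0 + δ), C t)
    (h1 : (∫ t in (T / 2 - δ)..(T / 2 + δ), C t) < α) (hl : l ≠ 0) :
    ∃ ω m η, 0 < m ∧ 0 < η ∧ ∀ s, |s - ω| ≤ η →
      l * (C (s + δ) - C (s - δ)) ≤ -m ∧
      (s ≤ ω → m * (ω - s) ≤ l * ((∫ t in (s - δ)..(s + δ), C t) - α)) ∧
      (ω ≤ s → l * ((∫ t in (s - δ)..(s + δ), C t) - α) ≤ -m * (s - ω)) := by
  have cC := A.osc.contC
  have hT := A.Tpos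
  have cL : Continuous (fun s => ∫ t in (s - δ)..(s + δ), C t) :=
    continuous_iff_continuousAt.2 fun s => (L_deriv cC δ s).continuousAt
  obtain ⟨ω₀, hω₀, hLω⟩ := intermediate_value_Ioo' (by linarith : (0:ℝ) ≤ T / 2) cL.continuousOn
    ⟨h1, h0⟩
  simp only at hLω
  have hd := A.diff_neg hδ hδT hω₀.1 hω₀.2
  obtain ⟨ω, hω, hD⟩ : ∃ ω, (∫ t in (ω - δ)..(ω + δ), C t) = α ∧
      l * (C (ω + δ) - C (ω - δ)) < 0 := by
    rcases lt_or_gt_of_ne hl with h | h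
    · refine ⟨-ω₀, by rw [L_even A.even]; exact hLω, ?_⟩
      have e1 : C (-ω₀ + δ) = C (ω₀ - δ) := by rw [← A.even]; congr 1; ring
      have e2 : C (-ω₀ - δ) = C (ω₀ + δ) := by rw [← A.even]; congr 1; ring
      rw [e1, e2]
      exact mul_neg_of_neg_of_pos h (by linarith)
    · exact ⟨ω₀, hLω, mul_neg_of_pos_of_neg h (by linarith)⟩
  set m := -(l * (C (ω + δ) - C (ω - δ))) / 2 with hm
  have hmpos : 0 < m := by linarith
  have cd : Continuous (fun s => l * (C (s + δ) - C (s - δ))) := by fun_prop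
  have hev : ∀ᶠ s in nhds ω, l * (C (s + δ) - C (s - δ)) < -m :=
    cd.continuousAt.eventually_lt_const (by linarith)
  obtain ⟨η, hη, hηb⟩ := Metric.eventually_nhds_iff_ball.1 hev
  have key : ∀ s, |s - ω| ≤ η / 2 → l * (C (s + δ) - C (s - δ)) ≤ -m := fun s hs =>
    (hηb s (by rw [Metric.mem_ball, Real.dist_eq]; linarith)).le
  refine ⟨ω, m, η / 2, hmpos, by linarith, fun s hs => ⟨key s hs, fun h => ?_, fun h => ?_⟩⟩
  all_goals
    have hdM : ∀ u, HasDerivAt (fun s => l * ((∫ t in (s - δ)..(s + δ), C t) - α))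
        (l * (C (u + δ) - C (u - δ))) u := fun u =>
      ((L_deriv cC δ u).sub_const α).const_mul l
    rw [abs_le] at hs
  · have := (convex_Icc s ω).image_sub_le_mul_sub_of_deriv_le
      (f := fun s => l * ((∫ t in (s - δ)..(s + δ), C t) - α)) (C := -m)
      (fun u _ => (hdM u).continuousAt.continuousWithinAt)
      (fun u _ => (hdM u).differentiableAt.differentiableWithinAt)
      (fun u hu => by
        rw [interior_Icc] at hu
        rw [(hdM u).deriv]; apply key; rw [abs_le]; constructor <;> linarith [hu.1, hu.2])
      s ⟨le_refl _, h⟩ ω ⟨h, le_refl _⟩ h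
    simp only [hω] at this
    linarith
  · have := (convex_Icc ω s).image_sub_le_mul_sub_of_deriv_le
      (f := fun s => l * ((∫ t in (s - δ)..(s + δ), C t) - α)) (C := -m)
      (fun u _ => (hdM u).continuousAt.continuousWithinAt)
      (fun u _ => (hdM u).differentiableAt.differentiableWithinAt)
      (fun u hu => by
        rw [interior_Icc] at hu
        rw [(hdM u).deriv]; apply key; rw [abs_le]; constructor <;> linarith [hu.1, hu.2])
      ω ⟨le_refl _, h⟩ s ⟨h, le_refl _⟩ h
    simp only [hω] at this
    linarith

lemma box1 {n : ℕ} (hn : 1 ≤ n) {a₁ b₁ a₂ b₂ T δ₁ δ α l : ℝ} {C₁ S₁ C₂ S₂ : ℝ → ℝ}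
    (A₁ : Asym a₁ b₁ T δ₁ C₁ S₁) (A₂ : Asym a₂ b₂ T δ C₂ S₂) (hT : n * T = 2 * π)
    (hα : α = 1 / √a₁ - √a₁ / b₁)
    (h0 : α < ∫ t in (0 - δ)..(0 + δ), C₁ t)
    (h1 : (∫ t in (T / 2 - δ)..(T / 2 + δ), C₁ t) < α) (hl : l ≠ 0) {W : ℝ} (hW : 0 < W) :
    ∃ ω η c, 0 < η ∧ η ≤ W ∧ 0 < c ∧ ∀ θ τ₁ τ₂,
      τ₁ ∈ Set.Icc (θ + ω - η) (θ + ω + η) → τ₂ ∈ Set.Icc (θ - η / 2) (θ + η / 2) →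
      l * (∫ t in (0:ℝ)..(2 * π), sg (C₂ (t + τ₂)) * S₁ (t + τ₁)) ≤ -(2 * c) ∧
      2 * c ≤ l * (∫ t in (0:ℝ)..(2 * π), sg (C₂ (t + τ₂)) * C₁ (t + (θ + ω - η))) ∧
      l * (∫ t in (0:ℝ)..(2 * π), sg (C₂ (t + τ₂)) * C₁ (t + (θ + ω + η))) ≤ -(2 * c) := by
  obtain ⟨ω, m, η₀, hm, hη₀, H⟩ := A₁.exists_omega (l := l) A₂.δpos A₂.δlt h0 h1 hl
  have cC := A₁.osc.contC
  have cS := A₁.osc.contS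
  have hn' : (1:ℝ) ≤ n := by exact_mod_cast hn
  set η := min (η₀ / 2) (min W 1) with hη
  have hηpos : 0 < η := by positivity
  have hη1 : η ≤ η₀ / 2 := min_le_left _ _
  have hηW : η ≤ W := (min_le_right _ _).trans (min_le_left _ _)
  have hηo : η ≤ 1 := (min_le_right _ _).trans (min_le_right _ _)
  have hintS : ∀ p q, ∫ t in p..q, S₁ t = C₁ q - C₁ p := fun p q =>
    intervalIntegral.integral_eq_sub_of_hasDerivAt (fun t _ => A₁.osc.dC t)
      (cS.intervalIntegrable _ _)
  have iC : ∫ t in (-δ)..(T - δ), C₁ t = 2 * α := by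
    rw [hα, ← A₁.int_C]
    have h : Function.Periodic C₁ T := A₁.osc.perC
    have := h.intervalIntegral_add_eq (-δ) (-δ₁)
    rw [show T - δ = -δ + T by ring, show T - δ₁ = -δ₁ + T by ring]; exact this
  have iS : ∫ t in (-δ)..(T - δ), S₁ t = 0 := by
    rw [hintS, show T - δ = -δ + T by ring, A₁.osc.perC, sub_self]
  refine ⟨ω, η, m * η / 2, hηpos, hηW, by positivity, fun θ τ₁ τ₂ h₁ h₂ => ⟨?_, ?_, ?_⟩⟩
  · rw [A₂.sg_int hT cS A₁.osc.perS, iS, hintS]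
    have := (H (τ₁ - τ₂) (by rw [abs_le]; constructor <;> linarith [h₁.1, h₁.2, h₂.1, h₂.2])).1
    have h3 : (n:ℝ) * (l * (C₁ (τ₁ - τ₂ + δ) - C₁ (τ₁ - τ₂ - δ))) ≤ 1 * (-m) :=
      by nlinarith
    nlinarith
  · rw [A₂.sg_int hT cC A₁.osc.perC, iC]
    have := (H (θ + ω - η - τ₂) (by rw [abs_le]; constructor <;> linarith [h₂.1, h₂.2])).2.1
      (by linarith [h₂.1])
    have h3 : m * (η / 2) ≤ m * (ω - (θ + ω - η - τ₂)) :=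
      mul_le_mul_of_nonneg_left (by linarith [h₂.1]) hm.le
    set X := l * ((∫ t in (θ + ω - η - τ₂ - δ)..(θ + ω - η - τ₂ + δ), C₁ t) - α)
    have h4 : m * (η / 2) ≤ X := h3.trans this
    have h5 : 1 * X ≤ n * X := mul_le_mul_of_nonneg_right hn' (le_trans (by positivity) h4)
    calc 2 * (m * η / 2) ≤ 2 * (n * X) := by linarith
      _ = _ := by ring
  · rw [A₂.sg_int hT cC A₁.osc.perC, iC]
    have := (H (θ + ω + η - τ₂) (by rw [abs_le]; constructor <;> linarith [h₂.1, h₂.2])).2.2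
      (by linarith [h₂.2])
    have h3 : m * (η / 2) ≤ m * ((θ + ω + η - τ₂) - ω) :=
      mul_le_mul_of_nonneg_left (by linarith [h₂.2]) hm.le
    set X := l * ((∫ t in (θ + ω + η - τ₂ - δ)..(θ + ω + η - τ₂ + δ), C₁ t) - α)
    have h4 : X ≤ -(m * (η / 2)) := by linarith
    have h5 : n * X ≤ 1 * X := mul_le_mul_of_nonpos_right hn' (by have : 0 < m * (η / 2) := by positivity
                                                                  linarith)
    calc _ = 2 * (n * X) := by ring
      _ ≤ _ := by linarith

/-! ### The phase box for the second oscillator -/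

lemma box2 {a b : ℝ} {C S : ℝ → ℝ} (o : Osc a b (2 * π) C S) (ev : ∀ t, C (-t) = C t) {N : ℕ}
    (hN : 1 ≤ N) (hκ : ∫ t in (0:ℝ)..(2 * π), C t * Real.cos (N * t) ≠ 0) {W : ℝ} (hW : 0 < W) :
    ∃ θ ε g, 0 < ε ∧ ε ≤ W ∧ 0 < g ∧
      (∀ τ ∈ Set.Icc (θ - ε) (θ + ε), g ≤ ∫ t in (0:ℝ)..(2 * π), Real.cos (N * t) * S (t + τ)) ∧
      (∫ t in (0:ℝ)..(2 * π), Real.cos (N * t) * C (t + (θ - ε))) ≤ -g ∧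
      g ≤ ∫ t in (0:ℝ)..(2 * π), Real.cos (N * t) * C (t + (θ + ε)) := by
  set κ := ∫ t in (0:ℝ)..(2 * π), C t * Real.cos (N * t) with hk
  have hN0 : (0:ℝ) < N := by exact_mod_cast hN
  have hN1 : (1:ℝ) ≤ N := by exact_mod_cast hN
  have f1 : ∀ σ, ∫ t in (0:ℝ)..(2 * π), Real.cos (N * t) * C (t + σ) = Real.cos (N * σ) * κ :=
    fun σ => fourier_corr o.contC ev o.perC N σ
  have f2 : ∀ σ, ∫ t in (0:ℝ)..(2 * π), Real.cos (N * t) * S (t + σ)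
      = -(N * Real.sin (N * σ)) * κ := by
    intro σ
    have h1 := o.corr_deriv (q := fun t => Real.cos (N * t)) (by fun_prop) σ
    simp only [f1] at h1
    have h2 : HasDerivAt (fun σ => Real.cos (N * σ) * κ) (-(N * Real.sin (N * σ)) * κ) σ := by
      have := (((hasDerivAt_id σ).const_mul (N:ℝ)).cos).mul_const κ
      exact this.congr_deriv (by simp only [id]; ring)
    exact h1.unique h2
  obtain ⟨θ, hθ⟩ : ∃ θ, ∀ u, Real.cos (N * (θ + u)) * κ = Real.sin (N * u) * |κ| ∧
      -(Real.sin (N * (θ + u))) * κ = Real.cos (N * u) * |κ| := by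
    rcases lt_or_gt_of_ne hκ with h | h
    · refine ⟨π / 2 / N, fun u => ?_⟩
      have : N * (π / 2 / N + u) = N * u + π / 2 := by field_simp; ring
      rw [this, Real.cos_add_pi_div_two, Real.sin_add_pi_div_two, abs_of_neg h]
      constructor <;> ring
    · refine ⟨-(π / 2 / N), fun u => ?_⟩
      have : N * (-(π / 2 / N) + u) = N * u - π / 2 := by field_simp; ring
      rw [this, Real.cos_sub_pi_div_two, Real.sin_sub_pi_div_two, abs_of_pos h]
      constructor <;> ring
  set ε := min W (1 / N) with hε
  have hεpos : 0 < ε := by positivity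
  have hεN : N * ε ≤ 1 := by
    calc N * ε ≤ N * (1 / N) := mul_le_mul_of_nonneg_left (min_le_right _ _) hN0.le
      _ = 1 := by field_simp
  have hκ' : 0 < |κ| := abs_pos.2 hκ
  have hsin : 0 < Real.sin (N * ε) :=
    Real.sin_pos_of_pos_of_lt_pi (by positivity) (by linarith [Real.pi_gt_three])
  have hcos : 0 < Real.cos 1 := Real.cos_one_pos
  set g := min (Real.sin (N * ε) * |κ|) (Real.cos 1 * |κ|) with hg
  refine ⟨θ, ε, g, hεpos, min_le_left _ _, by positivity, ?_, ?_, ?_⟩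
  · intro τ hτ
    rw [f2]
    have h := (hθ (τ - θ)).2
    rw [show θ + (τ - θ) = τ by ring] at h
    have hc : Real.cos 1 ≤ Real.cos (N * (τ - θ)) := by
      rw [← Real.cos_abs (N * (τ - θ))]
      apply Real.cos_le_cos_of_nonneg_of_le_pi (abs_nonneg _) (by linarith [Real.pi_gt_three])
      rw [abs_mul, abs_of_pos hN0]
      have : |τ - θ| ≤ ε := by rw [abs_le]; constructor <;> linarith [hτ.1, hτ.2]
      nlinarith
    have h2 : g ≤ Real.cos (N * (τ - θ)) * |κ| :=
      (min_le_right _ _).trans (mul_le_mul_of_nonneg_right hc hκ'.le)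
    have h3 : 0 < g := by positivity
    calc g ≤ Real.cos (N * (τ - θ)) * |κ| := h2
      _ ≤ N * (Real.cos (N * (τ - θ)) * |κ|) := by nlinarith
      _ = _ := by rw [← h]; ring
  · rw [f1, sub_eq_add_neg, (hθ (-ε)).1, mul_neg, Real.sin_neg]
    have := min_le_left (Real.sin (N * ε) * |κ|) (Real.cos 1 * |κ|)
    linarith
  · rw [f1, (hθ ε).1]
    exact min_le_left _ _

/-! ### One step of the return map and escape -/

lemma split_int {p f ψ : ℝ → ℝ} (cp : Continuous p) (cf : ContinuousOn f (Set.Icc 0 (2 * π)))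
    (cψ : Continuous ψ) : ∫ t in (0:ℝ)..(2 * π), (p t - f t) * ψ t
      = (∫ t in (0:ℝ)..(2 * π), p t * ψ t) - ∫ t in (0:ℝ)..(2 * π), f t * ψ t := by
  have h1 : IntervalIntegrable (fun t => p t * ψ t) volume 0 (2 * π) :=
    Osc.ii_of_cont (cp.mul cψ).continuousOn
  have h2 : IntervalIntegrable (fun t => f t * ψ t) volume 0 (2 * π) :=
    Osc.ii_of_cont (cf.mul cψ.continuousOn)
  rw [← intervalIntegral.integral_sub h1 h2]
  congr 1; funext t; ring

lemma onestep {a₁ b₁ a₂ b₂ T δ : ℝ} {C₁ S₁ C₂ S₂ : ℝ → ℝ} (o₁ : Osc a₁ b₁ (2 * π) C₁ S₁)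
    (o₂ : Osc a₂ b₂ (2 * π) C₂ S₂) (A₂ : Asym a₂ b₂ T δ C₂ S₂)
    {w₁ w₂ : ℝ}
    (hw₁ : ∀ σ τ, σ ≤ τ → τ ≤ σ + w₁ → a₁ / 2 * (τ - σ) ≤ C₁ τ * S₁ σ - S₁ τ * C₁ σ)
    (hw₂ : ∀ σ τ, σ ≤ τ → τ ≤ σ + w₂ → a₂ / 2 * (τ - σ) ≤ C₂ τ * S₂ σ - S₂ τ * C₂ σ)
    {s₁ s₂ u₁ u₂ : ℝ} (hs : s₁ < s₂) (hsw : s₂ ≤ s₁ + w₁) (hu : u₁ < u₂) (huw : u₂ ≤ u₁ + w₂)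
    {φ₁ φ₂ p q : ℝ → ℝ} {M₁ M₂ l c B P Q : ℝ} (cφ₁ : Continuous φ₁) (cφ₂ : Continuous φ₂)
    (hM₁ : ∀ x, |φ₁ x| ≤ M₁) (hM₂ : ∀ x, |φ₂ x| ≤ M₂)
    (htop : Tendsto φ₁ atTop (nhds l)) (hbot : Tendsto φ₁ atBot (nhds (-l)))
    (cp : Continuous p) (cq : Continuous q) (hP : ∀ t, |p t| ≤ P) (hQ : ∀ t, |q t| ≤ Q)
    (hc : 0 < c) (hB : ∀ t, |C₂ t| ≤ B ∧ |S₂ t| ≤ B)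
    (pC : ∀ σ, ∫ t in (0:ℝ)..(2 * π), p t * C₁ (t + σ) = 0)
    (pS : ∀ σ, ∫ t in (0:ℝ)..(2 * π), p t * S₁ (t + σ) = 0)
    (H₁ : ∀ τ₁ τ₂, τ₁ ∈ Set.Icc s₁ s₂ → τ₂ ∈ Set.Icc u₁ u₂ →
      l * (∫ t in (0:ℝ)..(2 * π), sg (C₂ (t + τ₂)) * S₁ (t + τ₁)) ≤ -(2 * c) ∧
      2 * c ≤ l * (∫ t in (0:ℝ)..(2 * π), sg (C₂ (t + τ₂)) * C₁ (t + s₁)) ∧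
      l * (∫ t in (0:ℝ)..(2 * π), sg (C₂ (t + τ₂)) * C₁ (t + s₂)) ≤ -(2 * c))
    (H₂ : ∀ τ₂ ∈ Set.Icc u₁ u₂,
      1 + M₂ * B * (2 * π) ≤ ∫ t in (0:ℝ)..(2 * π), q t * S₂ (t + τ₂))
    (H₃ : (∫ t in (0:ℝ)..(2 * π), q t * C₂ (t + u₁)) ≤ -(1 + M₂ * B * (2 * π)))
    (H₄ : 1 + M₂ * B * (2 * π) ≤ ∫ t in (0:ℝ)..(2 * π), q t * C₂ (t + u₂)) :
    ∃ R > 0, ∃ d > 0, ∃ K ≥ 0, ∀ (x₁ v₁ x₂ v₂ : ℝ → ℝ) (r₁ r₂ τ₁ τ₂ : ℝ), R ≤ r₁ → R ≤ r₂ →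
      τ₁ ∈ Set.Icc s₁ s₂ → τ₂ ∈ Set.Icc u₁ u₂ →
      Sol a₁ b₁ (fun t => p t - φ₁ (x₂ t)) x₁ v₁ →
      Sol a₂ b₂ (fun t => q t - φ₂ (x₁ t)) x₂ v₂ →
      x₁ 0 = r₁ * C₁ τ₁ → v₁ 0 = r₁ * S₁ τ₁ → x₂ 0 = r₂ * C₂ τ₂ → v₂ 0 = r₂ * S₂ τ₂ →
      (∀ t ∈ Set.Icc (0:ℝ) (2 * π), |x₁ t - r₁ * C₁ (t + τ₁)| ≤ K ∧ |v₁ t - r₁ * S₁ (t + τ₁)| ≤ K)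
      ∧ (∀ t ∈ Set.Icc (0:ℝ) (2 * π),
        |x₂ t - r₂ * C₂ (t + τ₂)| ≤ K ∧ |v₂ t - r₂ * S₂ (t + τ₂)| ≤ K) ∧
      ∃ r₁' r₂' τ₁' τ₂', r₁ + d ≤ r₁' ∧ r₂ + d ≤ r₂' ∧ τ₁' ∈ Set.Icc s₁ s₂ ∧ τ₂' ∈ Set.Icc u₁ u₂ ∧
        x₁ (2 * π) = r₁' * C₁ τ₁' ∧ v₁ (2 * π) = r₁' * S₁ τ₁' ∧
        x₂ (2 * π) = r₂' * C₂ τ₂' ∧ v₂ (2 * π) = r₂' * S₂ τ₂' := by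
  have ha₁ := o₁.ha
  have ha₂ := o₂.ha
  have hP0 : 0 ≤ P := (abs_nonneg _).trans (hP 0)
  have hQ0 : 0 ≤ Q := (abs_nonneg _).trans (hQ 0)
  have hM₁0 : 0 ≤ M₁ := (abs_nonneg _).trans (hM₁ 0)
  have hM₂0 : 0 ≤ M₂ := (abs_nonneg _).trans (hM₂ 0)
  have hB0 : 0 ≤ B := (abs_nonneg _).trans (hB 0).1
  obtain ⟨B₁, hB₁1, hB₁⟩ := o₁.bounds
  have cC₁ := o₁.contC
  have cS₁ := o₁.contS
  have cC₂ := o₂.contC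
  have cS₂ := o₂.contS
  obtain ⟨K₁, hK₁, ap₁⟩ := o₁.approx (P + M₁) (by positivity)
  obtain ⟨K₂, hK₂, ap₂⟩ := o₂.approx (Q + M₂) (by positivity)
  obtain ⟨R₁, hR₁, st₁⟩ := o₁.step hw₁ hs hsw (F := P + M₁) (by positivity) hc hK₁
  obtain ⟨R₂, hR₂, st₂⟩ := o₂.step hw₂ hu huw (F := Q + M₂) (by positivity) one_pos hK₂
  obtain ⟨R₃, hR₃, pa⟩ := A₂.phi_approx o₂.perC cφ₁ hM₁ htop hbot hK₂ (B := B₁) (by positivity) hc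
  refine ⟨max R₁ (max R₂ R₃), by positivity, min (c / (2 * a₁)) (1 / (2 * a₂)), by positivity,
    max K₁ K₂, by positivity, ?_⟩
  intro x₁ v₁ x₂ v₂ r₁ r₂ τ₁ τ₂ hr₁ hr₂ hτ₁ hτ₂ so₁ so₂ e1 e2 e3 e4
  have g1 : R₁ ≤ r₁ := (le_max_left _ _).trans hr₁
  have g2 : R₂ ≤ r₂ := ((le_max_left _ _).trans (le_max_right _ _)).trans hr₂
  have g3 : R₃ ≤ r₂ := ((le_max_right _ _).trans (le_max_right _ _)).trans hr₂
  have b1 : ∀ t ∈ Set.Icc (0:ℝ) (2 * π), |p t - φ₁ (x₂ t)| ≤ P + M₁ := fun t _ =>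
    (abs_sub _ _).trans (add_le_add (hP t) (hM₁ _))
  have b2 : ∀ t ∈ Set.Icc (0:ℝ) (2 * π), |q t - φ₂ (x₁ t)| ≤ Q + M₂ := fun t _ =>
    (abs_sub _ _).trans (add_le_add (hQ t) (hM₂ _))
  have k1 := ap₁ r₁ τ₁ _ x₁ v₁ (by linarith) so₁ b1 e1 e2
  have k2 := ap₂ r₂ τ₂ _ x₂ v₂ (by linarith) so₂ b2 e3 e4
  have cx₁ := Osc.Sol.contX so₁
  have cx₂ := Osc.Sol.contX so₂
  have cφx₂ : ContinuousOn (fun t => φ₁ (x₂ t)) (Set.Icc 0 (2 * π)) := cφ₁.comp_continuousOn cx₂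
  have cφx₁ : ContinuousOn (fun t => φ₂ (x₁ t)) (Set.Icc 0 (2 * π)) := cφ₂.comp_continuousOn cx₁
  have split1 : ∀ ψ : ℝ → ℝ, Continuous ψ → ∫ t in (0:ℝ)..(2 * π), (p t - φ₁ (x₂ t)) * ψ t
      = (∫ t in (0:ℝ)..(2 * π), p t * ψ t) - ∫ t in (0:ℝ)..(2 * π), φ₁ (x₂ t) * ψ t := by
    intro ψ cψ
    exact split_int cp cφx₂ cψ
  have split2 : ∀ ψ : ℝ → ℝ, Continuous ψ → ∫ t in (0:ℝ)..(2 * π), (q t - φ₂ (x₁ t)) * ψ t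
      = (∫ t in (0:ℝ)..(2 * π), q t * ψ t) - ∫ t in (0:ℝ)..(2 * π), φ₂ (x₁ t) * ψ t := by
    intro ψ cψ
    exact split_int cq cφx₁ cψ
  have bd2 : ∀ ψ : ℝ → ℝ, (∀ t, |ψ t| ≤ B) →
      |∫ t in (0:ℝ)..(2 * π), φ₂ (x₁ t) * ψ t| ≤ M₂ * B * (2 * π) := by
    intro ψ hψ
    apply Osc.abs_int_le
    intro t _
    rw [abs_mul]
    exact mul_le_mul (hM₂ _) (hψ t) (abs_nonneg _) hM₂0
  obtain ⟨h1, h2, h3⟩ := H₁ τ₁ τ₂ hτ₁ hτ₂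
  have q1 := abs_le.1 (pa r₂ τ₂ x₂ (fun t => S₁ (t + τ₁)) g3 cx₂ (fun t ht => (k2 t ht).1)
    (by fun_prop) (fun t => (hB₁ _).2))
  have q2 := abs_le.1 (pa r₂ τ₂ x₂ (fun t => C₁ (t + s₁)) g3 cx₂ (fun t ht => (k2 t ht).1)
    (by fun_prop) (fun t => (hB₁ _).1))
  have q3 := abs_le.1 (pa r₂ τ₂ x₂ (fun t => C₁ (t + s₂)) g3 cx₂ (fun t ht => (k2 t ht).1)
    (by fun_prop) (fun t => (hB₁ _).1))
  have z1 := split1 (fun t => S₁ (t + τ₁)) (by fun_prop)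
  have z2 := split1 (fun t => C₁ (t + s₁)) (by fun_prop)
  have z3 := split1 (fun t => C₁ (t + s₂)) (by fun_prop)
  have z4 := split2 (fun t => S₂ (t + τ₂)) (by fun_prop)
  have z5 := split2 (fun t => C₂ (t + u₁)) (by fun_prop)
  have z6 := split2 (fun t => C₂ (t + u₂)) (by fun_prop)
  have y4 := abs_le.1 (bd2 (fun t => S₂ (t + τ₂)) (fun t => (hB _).2))
  have y5 := abs_le.1 (bd2 (fun t => C₂ (t + u₁)) (fun t => (hB _).1))
  have y6 := abs_le.1 (bd2 (fun t => C₂ (t + u₂)) (fun t => (hB _).1))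
  rw [pS] at z1
  rw [pC] at z2 z3
  have := H₂ τ₂ hτ₂
  obtain ⟨r₁', τ₁', i1, i2, i3, i4⟩ := st₁ r₁ τ₁ (fun t => p t - φ₁ (x₂ t)) x₁ v₁ g1 hτ₁ so₁
    (cp.continuousOn.sub cφx₂) b1 e1 e2 k1 (by rw [z1]; linarith [q1.2])
    (by rw [z2]; linarith [q2.1]) (by rw [z3]; linarith [q3.2])
  obtain ⟨r₂', τ₂', j1, j2, j3, j4⟩ := st₂ r₂ τ₂ (fun t => q t - φ₂ (x₁ t)) x₂ v₂ g2 hτ₂ so₂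
    (cq.continuousOn.sub cφx₁) b2 e3 e4 k2 (by rw [z4]; linarith [y4.2])
    (by rw [z5]; linarith [y5.1]) (by rw [z6]; linarith [y6.2])
  have m1 := min_le_left (c / (2 * a₁)) (1 / (2 * a₂))
  have m2 := min_le_right (c / (2 * a₁)) (1 / (2 * a₂))
  exact ⟨fun t ht => ⟨(k1 t ht).1.trans (le_max_left _ _), (k1 t ht).2.trans (le_max_left _ _)⟩,
    fun t ht => ⟨(k2 t ht).1.trans (le_max_right _ _), (k2 t ht).2.trans (le_max_right _ _)⟩,
    r₁', r₂', τ₁', τ₂', by linarith, by linarith, i2, j2, i3, i4, j3, j4⟩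

lemma growth {a b T : ℝ} {C S : ℝ → ℝ} (o : Osc a b T C S) {x v : ℝ → ℝ} {R d K : ℝ} (hR : 0 < R)
    (hd : 0 < d)
    (h : ∀ k : ℕ, ∃ r τ, R + k * d ≤ r ∧ ∀ t ∈ Set.Icc (0:ℝ) (2 * π),
      |x (t + k * (2 * π)) - r * C (t + τ)| ≤ K ∧ |v (t + k * (2 * π)) - r * S (t + τ)| ≤ K) :
    Tendsto (fun t => x t ^ 2 + v t ^ 2) atTop atTop := by
  have ha := o.ha
  have hb := o.hb
  have hpi := Real.pi_pos
  set e := a / (1 + a + b) with he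
  have hepos : 0 < e := by positivity
  have hlow : ∀ t, e ≤ C t ^ 2 + S t ^ 2 := fun t => by
    rw [he, div_le_iff₀ (by positivity)]; linarith [o.lower t]
  have key : ∀ t, 0 ≤ t → e / 2 * (R + (t / (2 * π) - 1) * d) ^ 2 * 1 - 2 * K ^ 2
      ≤ x t ^ 2 + v t ^ 2 ∨ t < 2 * π := by
    intro t ht
    by_cases h2 : t < 2 * π
    · exact Or.inr h2
    left
    push Not at h2
    set k := ⌊t / (2 * π)⌋₊ with hk
    have k1 : (k:ℝ) ≤ t / (2 * π) := Nat.floor_le (by positivity)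
    have k2 : t / (2 * π) < k + 1 := Nat.lt_floor_add_one _
    have k1' : k * (2 * π) ≤ t := by rwa [le_div_iff₀ (by positivity)] at k1
    have k2' : t < (k + 1) * (2 * π) := by rwa [div_lt_iff₀ (by positivity)] at k2
    have k3 : 1 ≤ t / (2 * π) := by rw [le_div_iff₀ (by positivity)]; linarith
    obtain ⟨r, τ, hr, hap⟩ := h k
    obtain ⟨p1, p2⟩ := hap (t - k * (2 * π)) ⟨by linarith, by linarith⟩
    rw [sub_add_cancel] at p1 p2
    have l1 := hlow (t - k * (2 * π) + τ)
    set c' := C (t - k * (2 * π) + τ)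
    set s' := S (t - k * (2 * π) + τ)
    have hK0 : 0 ≤ K := (abs_nonneg _).trans p1
    have q1 : (x t - r * c') ^ 2 ≤ K ^ 2 := by rw [← sq_abs]; gcongr
    have q2 : (v t - r * s') ^ 2 ≤ K ^ 2 := by rw [← sq_abs]; gcongr
    have q3 : r ^ 2 * c' ^ 2 ≤ 2 * x t ^ 2 + 2 * (x t - r * c') ^ 2 := by
      nlinarith [sq_nonneg (2 * x t - r * c')]
    have q4 : r ^ 2 * s' ^ 2 ≤ 2 * v t ^ 2 + 2 * (v t - r * s') ^ 2 := by
      nlinarith [sq_nonneg (2 * v t - r * s')]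
    have q5 : 0 ≤ R + (t / (2 * π) - 1) * d := by
      have : 0 ≤ (t / (2 * π) - 1) * d := mul_nonneg (by linarith) hd.le
      linarith
    have q6 : R + (t / (2 * π) - 1) * d ≤ r := by
      have : (t / (2 * π) - 1) * d ≤ k * d := mul_le_mul_of_nonneg_right (by linarith) hd.le
      linarith
    have q7 : (R + (t / (2 * π) - 1) * d) ^ 2 ≤ r ^ 2 := by gcongr
    have q8 : r ^ 2 * e ≤ r ^ 2 * (c' ^ 2 + s' ^ 2) := by gcongr
    have q9 : e * (R + (t / (2 * π) - 1) * d) ^ 2 ≤ e * r ^ 2 := by gcongr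
    nlinarith
  have hlim : Tendsto (fun t : ℝ => e / 2 * (R + (t / (2 * π) - 1) * d) ^ 2 * 1 - 2 * K ^ 2)
      atTop atTop := by
    have t1 : Tendsto (fun t : ℝ => R + (t / (2 * π) - 1) * d) atTop atTop := by
      apply tendsto_atTop_add_const_left
      apply Tendsto.atTop_mul_const hd
      exact tendsto_atTop_add_const_right _ _ (tendsto_id.atTop_div_const (by positivity))
    have t2 := (tendsto_pow_atTop (α := ℝ) (two_ne_zero)).comp t1
    simp only [mul_one, sub_eq_add_neg]
    exact tendsto_atTop_add_const_right _ _ (t2.const_mul_atTop (by positivity))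
  refine tendsto_atTop_mono' _ ?_ hlim
  filter_upwards [eventually_ge_atTop (2 * π)] with t ht
  rcases key t (by linarith) with h | h
  · exact h
  · linarith

lemma Sol.shift {a b : ℝ} {f x v : ℝ → ℝ} (k : ℕ)
    (h : ∀ t ∈ Set.Ici (0:ℝ), HasDerivAt x (v t) t ∧ HasDerivAt v (f t - gg a b (x t)) t) :
    Sol a b (fun t => f (t + k * (2 * π))) (fun t => x (t + k * (2 * π)))
      (fun t => v (t + k * (2 * π))) := by
  intro t ht
  have hpi := Real.pi_pos
  obtain ⟨h1, h2⟩ := h (t + k * (2 * π)) (by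
    have : (0:ℝ) ≤ k * (2 * π) := by positivity
    exact add_nonneg ht.1 this)
  exact ⟨h1.comp_add_const _ _, h2.comp_add_const _ _⟩

def StepC (a₁ b₁ a₂ b₂ : ℝ) (C₁ S₁ C₂ S₂ p q φ₁ φ₂ : ℝ → ℝ) (s₁ s₂ u₁ u₂ R d K : ℝ) : Prop :=
  ∀ (x₁ v₁ x₂ v₂ : ℝ → ℝ) (r₁ r₂ τ₁ τ₂ : ℝ), R ≤ r₁ → R ≤ r₂ →
      τ₁ ∈ Set.Icc s₁ s₂ → τ₂ ∈ Set.Icc u₁ u₂ →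
      Sol a₁ b₁ (fun t => p t - φ₁ (x₂ t)) x₁ v₁ →
      Sol a₂ b₂ (fun t => q t - φ₂ (x₁ t)) x₂ v₂ →
      x₁ 0 = r₁ * C₁ τ₁ → v₁ 0 = r₁ * S₁ τ₁ → x₂ 0 = r₂ * C₂ τ₂ → v₂ 0 = r₂ * S₂ τ₂ →
      (∀ t ∈ Set.Icc (0:ℝ) (2 * π), |x₁ t - r₁ * C₁ (t + τ₁)| ≤ K ∧ |v₁ t - r₁ * S₁ (t + τ₁)| ≤ K)
      ∧ (∀ t ∈ Set.Icc (0:ℝ) (2 * π),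
        |x₂ t - r₂ * C₂ (t + τ₂)| ≤ K ∧ |v₂ t - r₂ * S₂ (t + τ₂)| ≤ K) ∧
      ∃ r₁' r₂' τ₁' τ₂', r₁ + d ≤ r₁' ∧ r₂ + d ≤ r₂' ∧ τ₁' ∈ Set.Icc s₁ s₂ ∧ τ₂' ∈ Set.Icc u₁ u₂ ∧
        x₁ (2 * π) = r₁' * C₁ τ₁' ∧ v₁ (2 * π) = r₁' * S₁ τ₁' ∧
        x₂ (2 * π) = r₂' * C₂ τ₂' ∧ v₂ (2 * π) = r₂' * S₂ τ₂'

lemma per_nat {f : ℝ → ℝ} (per : ∀ t, f (t + 2 * π) = f t) (k : ℕ) (t : ℝ) :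
    f (t + k * (2 * π)) = f t := by
  have := per_int per (k : ℤ) t
  simpa using this

lemma escape {a₁ b₁ a₂ b₂ T₁ T₂ : ℝ} {C₁ S₁ C₂ S₂ p q φ₁ φ₂ : ℝ → ℝ} {s₁ s₂ u₁ u₂ R d K : ℝ}
    (o₁ : Osc a₁ b₁ T₁ C₁ S₁) (o₂ : Osc a₂ b₂ T₂ C₂ S₂) (hR : 0 < R) (hd : 0 < d)
    (H : StepC a₁ b₁ a₂ b₂ C₁ S₁ C₂ S₂ p q φ₁ φ₂ s₁ s₂ u₁ u₂ R d K)
    (pp : ∀ t, p (t + 2 * π) = p t) (pq : ∀ t, q (t + 2 * π) = q t) {x₁ v₁ x₂ v₂ : ℝ → ℝ}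
    (so₁ : ∀ t ∈ Set.Ici (0:ℝ), HasDerivAt x₁ (v₁ t) t ∧
      HasDerivAt v₁ ((p t - φ₁ (x₂ t)) - gg a₁ b₁ (x₁ t)) t)
    (so₂ : ∀ t ∈ Set.Ici (0:ℝ), HasDerivAt x₂ (v₂ t) t ∧
      HasDerivAt v₂ ((q t - φ₂ (x₁ t)) - gg a₂ b₂ (x₂ t)) t)
    (hstart : ∃ r₁ r₂ τ₁ τ₂, R ≤ r₁ ∧ R ≤ r₂ ∧ τ₁ ∈ Set.Icc s₁ s₂ ∧ τ₂ ∈ Set.Icc u₁ u₂ ∧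
      x₁ 0 = r₁ * C₁ τ₁ ∧ v₁ 0 = r₁ * S₁ τ₁ ∧ x₂ 0 = r₂ * C₂ τ₂ ∧ v₂ 0 = r₂ * S₂ τ₂) :
    Tendsto (fun t => x₁ t ^ 2 + v₁ t ^ 2) atTop atTop ∧
    Tendsto (fun t => x₂ t ^ 2 + v₂ t ^ 2) atTop atTop := by
  have A : ∀ k : ℕ, ∀ r₁ r₂ τ₁ τ₂, R ≤ r₁ → R ≤ r₂ →
      τ₁ ∈ Set.Icc s₁ s₂ → τ₂ ∈ Set.Icc u₁ u₂ →
      x₁ (k * (2 * π)) = r₁ * C₁ τ₁ → v₁ (k * (2 * π)) = r₁ * S₁ τ₁ →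
      x₂ (k * (2 * π)) = r₂ * C₂ τ₂ → v₂ (k * (2 * π)) = r₂ * S₂ τ₂ → _ :=
    fun k r₁ r₂ τ₁ τ₂ h1 h2 h3 h4 h5 h6 h7 h8 =>
      H (fun t => x₁ (t + k * (2 * π))) (fun t => v₁ (t + k * (2 * π)))
        (fun t => x₂ (t + k * (2 * π))) (fun t => v₂ (t + k * (2 * π))) r₁ r₂ τ₁ τ₂ h1 h2 h3 h4
        (by have := Sol.shift k so₁; simpa only [per_nat pp] using this)
        (by have := Sol.shift k so₂; simpa only [per_nat pq] using this)
        (by simpa using h5) (by simpa using h6) (by simpa using h7) (by simpa using h8)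
  have B : ∀ k : ℕ, ∃ r₁ r₂ τ₁ τ₂, R + k * d ≤ r₁ ∧ R + k * d ≤ r₂ ∧ τ₁ ∈ Set.Icc s₁ s₂ ∧
      τ₂ ∈ Set.Icc u₁ u₂ ∧ x₁ (k * (2 * π)) = r₁ * C₁ τ₁ ∧ v₁ (k * (2 * π)) = r₁ * S₁ τ₁ ∧
      x₂ (k * (2 * π)) = r₂ * C₂ τ₂ ∧ v₂ (k * (2 * π)) = r₂ * S₂ τ₂ := by
    intro k
    induction k with
    | zero => simpa using hstart
    | succ k ih =>
      obtain ⟨r₁, r₂, τ₁, τ₂, h1, h2, h3, h4, h5, h6, h7, h8⟩ := ih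
      have hkd : (0:ℝ) ≤ k * d := by positivity
      obtain ⟨-, -, r₁', r₂', τ₁', τ₂', g1, g2, g3, g4, g5, g6, g7, g8⟩ :=
        A k r₁ r₂ τ₁ τ₂ (by linarith) (by linarith) h3 h4 h5 h6 h7 h8
      have e : ((k + 1 : ℕ) : ℝ) * (2 * π) = 2 * π + k * (2 * π) := by push_cast; ring
      have e' : ((k + 1 : ℕ) : ℝ) * d = k * d + d := by push_cast; ring
      rw [e, e']
      exact ⟨r₁', r₂', τ₁', τ₂', by linarith, by linarith, g3, g4, g5, g6, g7, g8⟩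
  constructor
  · refine growth o₁ hR hd (K := K) fun k => ?_
    obtain ⟨r₁, r₂, τ₁, τ₂, h1, h2, h3, h4, h5, h6, h7, h8⟩ := B k
    have hkd : (0:ℝ) ≤ k * d := by positivity
    exact ⟨r₁, τ₁, h1, (A k r₁ r₂ τ₁ τ₂ (by linarith) (by linarith) h3 h4 h5 h6 h7 h8).1⟩
  · refine growth o₂ hR hd (K := K) fun k => ?_
    obtain ⟨r₁, r₂, τ₁, τ₂, h1, h2, h3, h4, h5, h6, h7, h8⟩ := B k
    have hkd : (0:ℝ) ≤ k * d := by positivity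
    exact ⟨r₂, τ₂, h2, (A k r₁ r₂ τ₁ τ₂ (by linarith) (by linarith) h3 h4 h5 h6 h7 h8).2.1⟩

/-! ### Initial data sets of infinite measure -/

def Sect (a b : ℝ) (C S : ℝ → ℝ) (s₁ s₂ R x v : ℝ) : Prop :=
  0 < x * S s₁ - v * C s₁ ∧ x * S s₂ - v * C s₂ < 0 ∧ a * R ^ 2 < v ^ 2 + gg a b x * x

lemma Sect.polar {a b T : ℝ} {C S : ℝ → ℝ} (o : Osc a b T C S) {w : ℝ} (hw : ∀ σ τ, σ ≤ τ → τ ≤ σ + w →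
    a / 2 * (τ - σ) ≤ C τ * S σ - S τ * C σ) {s₁ s₂ : ℝ} (h12 : s₁ < s₂) (h21 : s₂ ≤ s₁ + w)
    {R x v : ℝ} (hR : 0 < R) (h : Sect a b C S s₁ s₂ R x v) :
    ∃ r τ, R ≤ r ∧ τ ∈ Set.Icc s₁ s₂ ∧ x = r * C τ ∧ v = r * S τ := by
  have ha := o.ha
  obtain ⟨h1, h2, h3⟩ := h
  obtain ⟨r, hr, τ, hτ, rfl, rfl⟩ := o.polar hw h12 h21
    (lt_of_le_of_lt (by positivity) h3) h1.le h2.le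
  refine ⟨r, τ, ?_, hτ, rfl, rfl⟩
  rw [gg_smul hr.le] at h3
  have e := o.en τ
  have h4 : a * R ^ 2 < a * r ^ 2 := by
    calc a * R ^ 2 < _ := h3
      _ = r ^ 2 * (S τ ^ 2 + gg a b (C τ) * C τ) := by ring
      _ = _ := by rw [e]; ring
  have h5 : R ^ 2 < r ^ 2 := lt_of_mul_lt_mul_left h4 ha.le
  exact (lt_of_pow_lt_pow_left₀ 2 hr.le h5).le

lemma Sect.nonempty {a b T : ℝ} {C S : ℝ → ℝ} (o : Osc a b T C S) {w : ℝ}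
    (hw : ∀ σ τ, σ ≤ τ → τ ≤ σ + w →
    a / 2 * (τ - σ) ≤ C τ * S σ - S τ * C σ) {s₁ s₂ : ℝ} (h12 : s₁ < s₂) (h21 : s₂ ≤ s₁ + w)
    {R : ℝ} (hR : 0 < R) : ∃ x v, Sect a b C S s₁ s₂ R x v := by
  have ha := o.ha
  set τ := (s₁ + s₂) / 2 with hτ
  have e := o.en τ
  have h1 := hw s₁ τ (by linarith) (by linarith)
  have h2 := hw τ s₂ (by linarith) (by linarith)
  have p1 : 0 < a / 2 * (τ - s₁) := mul_pos (by positivity) (by linarith)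
  have p2 : 0 < a / 2 * (s₂ - τ) := mul_pos (by positivity) (by linarith)
  refine ⟨(2 * R) * C τ, (2 * R) * S τ, ?_, ?_, ?_⟩
  · have : 0 < (2 * R) * (C τ * S s₁ - S τ * C s₁) := mul_pos (by positivity) (by linarith)
    linarith
  · have : 0 < (2 * R) * (C s₂ * S τ - S s₂ * C τ) := mul_pos (by positivity) (by linarith)
    linarith
  · rw [gg_smul (by positivity)]
    have : (2 * R * S τ) ^ 2 + 2 * R * gg a b (C τ) * (2 * R * C τ) = 4 * (a * R ^ 2) := by
      linear_combination (4 * R ^ 2) * e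
    rw [this]
    have : 0 < a * R ^ 2 := by positivity
    linarith

lemma Sect.dbl {a b : ℝ} {C S : ℝ → ℝ} {s₁ s₂ R x v : ℝ} (h : Sect a b C S s₁ s₂ R x v)
    (ha : 0 < a) : Sect a b C S s₁ s₂ R (2 * x) (2 * v) := by
  obtain ⟨h1, h2, h3⟩ := h
  refine ⟨by linarith, by linarith, ?_⟩
  rw [gg_smul (by norm_num)]
  have : 0 ≤ a * R ^ 2 := by positivity
  nlinarith

open scoped Pointwise in
lemma bigset {a₁ b₁ a₂ b₂ T₁ T₂ : ℝ} {C₁ S₁ C₂ S₂ : ℝ → ℝ}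
    (o₁ : Osc a₁ b₁ T₁ C₁ S₁) (o₂ : Osc a₂ b₂ T₂ C₂ S₂) {w₁ w₂ : ℝ}
    (hw₁ : ∀ σ τ, σ ≤ τ → τ ≤ σ + w₁ → a₁ / 2 * (τ - σ) ≤ C₁ τ * S₁ σ - S₁ τ * C₁ σ)
    (hw₂ : ∀ σ τ, σ ≤ τ → τ ≤ σ + w₂ → a₂ / 2 * (τ - σ) ≤ C₂ τ * S₂ σ - S₂ τ * C₂ σ)
    {s₁ s₂ u₁ u₂ R : ℝ} (hs : s₁ < s₂) (hsw : s₂ ≤ s₁ + w₁) (hu : u₁ < u₂) (huw : u₂ ≤ u₁ + w₂)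
    (hR : 0 < R) : ∃ E : Set (ℝ × ℝ × ℝ × ℝ), MeasurableSet E ∧ volume E = ⊤ ∧
    ∀ x₁ x₂ v₁ v₂, (x₁, x₂, v₁, v₂) ∈ E →
      ∃ r₁ r₂ τ₁ τ₂, R ≤ r₁ ∧ R ≤ r₂ ∧ τ₁ ∈ Set.Icc s₁ s₂ ∧ τ₂ ∈ Set.Icc u₁ u₂ ∧
      x₁ = r₁ * C₁ τ₁ ∧ v₁ = r₁ * S₁ τ₁ ∧ x₂ = r₂ * C₂ τ₂ ∧ v₂ = r₂ * S₂ τ₂ := by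
  set E : Set (ℝ × ℝ × ℝ × ℝ) := {z | Sect a₁ b₁ C₁ S₁ s₁ s₂ R z.1 z.2.2.1 ∧
    Sect a₂ b₂ C₂ S₂ u₁ u₂ R z.2.1 z.2.2.2} with hE
  have g1 := gg_continuous a₁ b₁
  have g2 := gg_continuous a₂ b₂
  have op : IsOpen E := by
    simp only [hE, Sect]
    refine IsOpen.and (IsOpen.and ?_ (IsOpen.and ?_ ?_)) (IsOpen.and ?_ (IsOpen.and ?_ ?_)) <;>
    exact isOpen_lt (by fun_prop) (by fun_prop)
  have ne : E.Nonempty := by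
    obtain ⟨x, v, h⟩ := Sect.nonempty o₁ hw₁ hs hsw hR
    obtain ⟨x', v', h'⟩ := Sect.nonempty o₂ hw₂ hu huw hR
    exact ⟨(x, x', v, v'), h, h'⟩
  have hpos : 0 < volume E := op.measure_pos volume ne
  refine ⟨E, op.measurableSet, ?_, ?_⟩
  · by_contra hfin
    have hsub : (2:ℝ) • E ⊆ E := by
      rintro _ ⟨z, ⟨h1, h2⟩, rfl⟩
      exact ⟨h1.dbl o₁.ha, h2.dbl o₂.ha⟩
    have h := measure_mono (μ := volume) hsub
    haveI i2 : (volume : Measure (ℝ × ℝ)).IsAddHaarMeasure :=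
      inferInstanceAs ((volume : Measure ℝ).prod (volume : Measure ℝ)).IsAddHaarMeasure
    haveI i3 : (volume : Measure (ℝ × ℝ × ℝ)).IsAddHaarMeasure :=
      inferInstanceAs ((volume : Measure ℝ).prod (volume : Measure (ℝ × ℝ))).IsAddHaarMeasure
    haveI i4 : (volume : Measure (ℝ × ℝ × ℝ × ℝ)).IsAddHaarMeasure :=
      inferInstanceAs ((volume : Measure ℝ).prod (volume : Measure (ℝ × ℝ × ℝ))).IsAddHaarMeasure
    rw [Measure.addHaar_smul] at h
    have hrank : Module.finrank ℝ (ℝ × ℝ × ℝ × ℝ) = 4 := by simp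
    rw [hrank] at h
    have h' := ENNReal.toReal_mono hfin h
    rw [ENNReal.toReal_mul, ENNReal.toReal_ofReal (abs_nonneg _)] at h'
    have h0 : 0 < (volume E).toReal := ENNReal.toReal_pos hpos.ne' hfin
    norm_num at h'
    linarith
  · rintro x₁ x₂ v₁ v₂ ⟨h1, h2⟩
    obtain ⟨r₁, τ₁, i1, i2, i3, i4⟩ := h1.polar o₁ hw₁ hs hsw hR
    obtain ⟨r₂, τ₂, j1, j2, j3, j4⟩ := h2.polar o₂ hw₂ hu huw hR
    exact ⟨r₁, r₂, τ₁, τ₂, i1, j1, i2, j2, i3, i4, j3, j4⟩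

lemma Asym.osc2 {n : ℕ} {a b T δ : ℝ} {C S : ℝ → ℝ} (A : Asym a b T δ C S) (hT : n * T = 2 * π) :
    Osc a b (2 * π) C S := by
  have o := A.osc
  refine ⟨o.ha, o.hb, o.dC, o.dS, fun t => ?_, fun t => ?_, o.en⟩
  · rw [← hT]; simpa using per_int o.perC (n : ℤ) t
  · rw [← hT]; simpa using per_int o.perS (n : ℤ) t

lemma forward {n : ℕ} (hn : 1 ≤ n) {a₁ b₁ a₂ b₂ T δ₁ δ α l : ℝ} {C₁ S₁ C₂ S₂ : ℝ → ℝ}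
    (A₁ : Asym a₁ b₁ T δ₁ C₁ S₁) (A₂ : Asym a₂ b₂ T δ C₂ S₂) (hT : n * T = 2 * π)
    (hα : α = 1 / √a₁ - √a₁ / b₁)
    (h0 : α < ∫ t in (0 - δ)..(0 + δ), C₁ t)
    (h1 : (∫ t in (T / 2 - δ)..(T / 2 + δ), C₁ t) < α) (hl : l ≠ 0)
    {N : ℕ} (hN : 1 ≤ N) (hκ : ∫ t in (0:ℝ)..(2 * π), C₂ t * Real.cos (N * t) ≠ 0)
    {φ₁ φ₂ : ℝ → ℝ} {M₁ M₂ : ℝ} (cφ₁ : Continuous φ₁) (cφ₂ : Continuous φ₂)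
    (hM₁ : ∀ x, |φ₁ x| ≤ M₁) (hM₂ : ∀ x, |φ₂ x| ≤ M₂)
    (htop : Tendsto φ₁ atTop (nhds l)) (hbot : Tendsto φ₁ atBot (nhds (-l))) :
    ∃ μs > (0:ℝ), ∀ μ, μs < μ → ∀ p : ℝ → ℝ, Continuous p → (∀ t, p (t + 2 * π) = p t) →
      (∀ σ, ∫ t in (0:ℝ)..(2 * π), p t * C₁ (t + σ) = 0) →
      ∃ E : Set (ℝ × ℝ × ℝ × ℝ), MeasurableSet E ∧ volume E = ⊤ ∧
      ∀ x₁ x₂ v₁ v₂ : ℝ → ℝ,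
        (∀ t ∈ Set.Ici (0:ℝ), HasDerivAt x₁ (v₁ t) t ∧
          HasDerivAt v₁ ((p t - φ₁ (x₂ t)) - gg a₁ b₁ (x₁ t)) t) →
        (∀ t ∈ Set.Ici (0:ℝ), HasDerivAt x₂ (v₂ t) t ∧
          HasDerivAt v₂ ((μ * Real.cos (N * t) - φ₂ (x₁ t)) - gg a₂ b₂ (x₂ t)) t) →
        (x₁ 0, x₂ 0, v₁ 0, v₂ 0) ∈ E →
        Tendsto (fun t => x₁ t ^ 2 + v₁ t ^ 2) atTop atTop ∧
        Tendsto (fun t => x₂ t ^ 2 + v₂ t ^ 2) atTop atTop := by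
  have o₁ := A₁.osc2 hT
  have o₂ := A₂.osc2 hT
  have hpi := Real.pi_pos
  obtain ⟨w₁, hw₁p, hw₁⟩ := o₁.det_lower
  obtain ⟨w₂, hw₂p, hw₂⟩ := o₂.det_lower
  obtain ⟨B, hB1, hB⟩ := o₂.bounds
  have hM₂0 : 0 ≤ M₂ := (abs_nonneg _).trans (hM₂ 0)
  obtain ⟨ω, η, c, hη, hηw, hc, HB₁⟩ := box1 hn A₁ A₂ hT hα h0 h1 hl (W := w₁ / 2) (by positivity)
  obtain ⟨θ, ε, g, hε, hεw, hg, HB₂, HB₃, HB₄⟩ := box2 o₂ A₂.even hN hκ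
    (W := min (η / 2) (w₂ / 2)) (by positivity)
  have hε1 : ε ≤ η / 2 := hεw.trans (min_le_left _ _)
  have hε2 : ε ≤ w₂ / 2 := hεw.trans (min_le_right _ _)
  refine ⟨(1 + M₂ * B * (2 * π)) / g, by positivity, fun μ hμ p cp pp pC => ?_⟩
  rw [div_lt_iff₀ hg] at hμ
  have hμ0 : 0 < μ := by
    by_contra hh
    push Not at hh
    have h1 : μ * g ≤ 0 := mul_nonpos_of_nonpos_of_nonneg hh hg.le
    have h2 : 0 ≤ M₂ * B * (2 * π) := by positivity
    linarith
  have pS : ∀ σ, ∫ t in (0:ℝ)..(2 * π), p t * S₁ (t + σ) = 0 := by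
    intro σ
    have h := o₁.corr_deriv cp σ
    simp only [pC] at h
    exact h.unique (hasDerivAt_const σ (0:ℝ))
  obtain ⟨P, hP⟩ : ∃ P, ∀ t, |p t| ≤ P := by
    have hper : Function.Periodic p (2 * π) := pp
    obtain ⟨P, hP⟩ := (isCompact_Icc (a := (0:ℝ)) (b := 2 * π)).exists_bound_of_continuousOn
      cp.continuousOn
    refine ⟨P, fun t => ?_⟩
    obtain ⟨k, hk⟩ := exists_shift (T := 2 * π) (p := 0) (by positivity) t
    rw [← per_int pp k t]
    exact hP _ ⟨hk.1, by linarith [hk.2]⟩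
  have mulc : ∀ ψ : ℝ → ℝ, ∫ t in (0:ℝ)..(2 * π), μ * Real.cos (N * t) * ψ t
      = μ * ∫ t in (0:ℝ)..(2 * π), Real.cos (N * t) * ψ t := by
    intro ψ
    rw [← intervalIntegral.integral_const_mul]
    congr 1; funext t; ring
  obtain ⟨R, hR, d, hd, K, hK, H⟩ := onestep o₁ o₂ A₂ hw₁ hw₂
    (s₁ := θ + ω - η) (s₂ := θ + ω + η) (u₁ := θ - ε) (u₂ := θ + ε)
    (by linarith) (by linarith) (by linarith) (by linarith)
    (p := p) (q := fun t => μ * Real.cos (N * t)) (P := P) (Q := μ) (B := B) cφ₁ cφ₂ hM₁ hM₂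
    htop hbot cp (by fun_prop) hP
    (fun t => by
      rw [abs_mul, abs_of_pos hμ0]
      exact mul_le_of_le_one_right hμ0.le (Real.abs_cos_le_one _))
    hc hB pC pS
    (fun τ₁ τ₂ i j => HB₁ θ τ₁ τ₂ i ⟨by linarith [j.1], by linarith [j.2]⟩)
    (fun τ hτ => by
      rw [mulc (fun t => S₂ (t + τ))]
      have := mul_le_mul_of_nonneg_left (HB₂ τ hτ) hμ0.le
      linarith)
    (by
      rw [mulc (fun t => C₂ (t + (θ - ε)))]
      have := mul_le_mul_of_nonneg_left HB₃ hμ0.le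
      linarith)
    (by
      rw [mulc (fun t => C₂ (t + (θ + ε)))]
      have := mul_le_mul_of_nonneg_left HB₄ hμ0.le
      linarith)
  obtain ⟨E, hE1, hE2, hE3⟩ := bigset o₁ o₂ hw₁ hw₂
    (s₁ := θ + ω - η) (s₂ := θ + ω + η) (u₁ := θ - ε) (u₂ := θ + ε) (R := R)
    (by linarith) (by linarith) (by linarith) (by linarith) hR
  refine ⟨E, hE1, hE2, fun x₁ x₂ v₁ v₂ so₁ so₂ hin => ?_⟩
  refine escape o₁ o₂ hR hd (q := fun t => μ * Real.cos (N * t)) H pp ?_ so₁ so₂ (hE3 _ _ _ _ hin)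
  intro t
  rw [mul_add, Real.cos_add_nat_mul_two_pi]

theorem stmt14 (n : ℕ) (hn : 1 ≤ n)
    (a₁ b₁ a₂ b₂ : ℝ)
    (ha₁ : (n : ℝ) ^ 2 / 4 < a₁) (hb₁ : 0 < b₁)
    (ha₂ : (n : ℝ) ^ 2 / 4 < a₂) (hb₂ : 0 < b₂)
    (hres₁ : 1 / Real.sqrt a₁ + 1 / Real.sqrt b₁ = 2 / (n : ℝ))
    (hres₂ : 1 / Real.sqrt a₂ + 1 / Real.sqrt b₂ = 2 / (n : ℝ))
    (C₁ C₂ : ℝ → ℝ) (hC₁ : IsAsymCos n a₁ b₁ C₁) (hC₂ : IsAsymCos n a₂ b₂ C₂)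
    (γ₁ γ₂ α₁ α₂ : ℝ)
    (hγ₁ : γ₁ = Real.sqrt (2 * n / a₁)) (hγ₂ : γ₂ = Real.sqrt (2 * n / a₂))
    (hα₁ : α₁ = 1 / Real.sqrt a₁ - Real.sqrt a₁ / b₁)
    (hα₂ : α₂ = 1 / Real.sqrt a₂ - Real.sqrt a₂ / b₂)
    (K₁ K₂ : ℝ → ℝ)
    (hK₁ : ∀ t, K₁ t = ∫ s in (0 : ℝ)..t, C₁ s)
    (hK₂ : ∀ t, K₂ t = ∫ s in (0 : ℝ)..t, C₂ s)
    (Λ₁ Λ₂ : ℝ → ℝ)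
    (hΛ₁ : ∀ t, Λ₁ t = K₁ (t / n + π / (2 * Real.sqrt a₂)) - K₁ (t / n - π / (2 * Real.sqrt a₂)))
    (hΛ₂ : ∀ t, Λ₂ t = K₂ (t / n + π / (2 * Real.sqrt a₁)) - K₂ (t / n - π / (2 * Real.sqrt a₁)))
    (φ₁ φ₂ : ℝ → ℝ) (hφ₁lip : LocallyLipschitz φ₁) (hφ₂lip : LocallyLipschitz φ₂)
    (hφ₁bdd : ∃ M, ∀ x, |φ₁ x| ≤ M) (hφ₂bdd : ∃ M, ∀ x, |φ₂ x| ≤ M)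
    (φ₁inf φ₂inf : ℝ)
    (hφ₁top : Tendsto φ₁ atTop (nhds φ₁inf)) (hφ₁bot : Tendsto φ₁ atBot (nhds (-φ₁inf)))
    (hφ₂top : Tendsto φ₂ atTop (nhds φ₂inf)) (hφ₂bot : Tendsto φ₂ atBot (nhds (-φ₂inf)))
    (hresol : Λ₁ π < α₁ ∧ α₁ < Λ₁ 0)
    (r : ℕ) (hr : 1 ≤ r)
    (hcr2 : (1 / π) * ∫ t in (0 : ℝ)..(2 * π), C₂ t * Real.cos (r * n * t) ≠ 0)
    (p₁ : ℝ → ℝ) (hp₁ : Continuous p₁) (hp₁per : ∀ t, p₁ (t + 2 * π) = p₁ t)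
    (hΦ₁zero : ∀ θ : ℝ, -(γ₁ / 2) * ∫ t in (0 : ℝ)..(2 * π), C₁ (θ / n + t) * p₁ t = 0)
    (hφ₁ne : φ₁inf ≠ 0) :
    ∃ μstar > (0 : ℝ), ∀ μ : ℝ, μstar < μ →
      ∃ Eplus Eminus : Set (ℝ × ℝ × ℝ × ℝ),
        MeasurableSet Eplus ∧ volume Eplus = ⊤ ∧
        MeasurableSet Eminus ∧ volume Eminus = ⊤ ∧
        (∀ x₁ x₂ v₁ v₂ : ℝ → ℝ,
        (∀ t ∈ Set.Ici (0 : ℝ),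
          HasDerivAt x₁ (v₁ t) t ∧ HasDerivAt x₂ (v₂ t) t ∧
          HasDerivAt v₁ (p₁ t - a₁ * max (x₁ t) 0 + b₁ * max (-x₁ t) 0 - φ₁ (x₂ t)) t ∧
          HasDerivAt v₂ (μ * Real.cos (r * n * t) - a₂ * max (x₂ t) 0 + b₂ * max (-x₂ t) 0 - φ₂ (x₁ t)) t) →
        (x₁ 0, x₂ 0, v₁ 0, v₂ 0) ∈ Eplus →
        (Tendsto (fun t => (x₁ t) ^ 2 + (v₁ t) ^ 2) atTop atTop ∧
         Tendsto (fun t => (x₂ t) ^ 2 + (v₂ t) ^ 2) atTop atTop)) ∧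
        (∀ x₁ x₂ v₁ v₂ : ℝ → ℝ,
        (∀ t ∈ Set.Iic (0 : ℝ),
          HasDerivAt x₁ (v₁ t) t ∧ HasDerivAt x₂ (v₂ t) t ∧
          HasDerivAt v₁ (p₁ t - a₁ * max (x₁ t) 0 + b₁ * max (-x₁ t) 0 - φ₁ (x₂ t)) t ∧
          HasDerivAt v₂ (μ * Real.cos (r * n * t) - a₂ * max (x₂ t) 0 + b₂ * max (-x₂ t) 0 - φ₂ (x₁ t)) t) →
        (x₁ 0, x₂ 0, v₁ 0, v₂ 0) ∈ Eminus →
        (Tendsto (fun t => (x₁ t) ^ 2 + (v₁ t) ^ 2) atBot atTop ∧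
         Tendsto (fun t => (x₂ t) ^ 2 + (v₂ t) ^ 2) atBot atTop)) := by
  have hn0 : (0:ℝ) < n := by exact_mod_cast hn
  have hpi := Real.pi_pos
  have ha₁' : 0 < a₁ := lt_of_le_of_lt (by positivity) ha₁
  have ha₂' : 0 < a₂ := lt_of_le_of_lt (by positivity) ha₂
  obtain ⟨S₁, A₁⟩ := asym_of n hn ha₁' hb₁ hres₁ hC₁
  obtain ⟨S₂, A₂⟩ := asym_of n hn ha₂' hb₂ hres₂ hC₂
  have hT : (n:ℝ) * (2 * π / n) = 2 * π := by field_simp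
  have cC₁ := A₁.osc.contC
  have hΛ : ∀ t, Λ₁ t = ∫ s in (t / n - π / (2 * √a₂))..(t / n + π / (2 * √a₂)), C₁ s := by
    intro t
    rw [hΛ₁, hK₁, hK₁, intervalIntegral.integral_interval_sub_left] <;>
      exact cC₁.intervalIntegrable _ _
  have h0 : α₁ < ∫ s in (0 - π / (2 * √a₂))..(0 + π / (2 * √a₂)), C₁ s := by
    have := hresol.2
    rw [hΛ, zero_div] at this
    exact this
  have h1 : (∫ s in (2 * π / n / 2 - π / (2 * √a₂))..(2 * π / n / 2 + π / (2 * √a₂)), C₁ s)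
      < α₁ := by
    have := hresol.1
    rw [hΛ] at this
    rw [show 2 * π / n / 2 = π / n by ring]
    exact this
  have hN : 1 ≤ r * n := Nat.mul_pos hr hn
  have hNc : ∀ t : ℝ, ((r * n : ℕ) : ℝ) * t = r * n * t := fun t => by push_cast; ring
  have hκ : ∫ t in (0:ℝ)..(2 * π), C₂ t * Real.cos ((r * n : ℕ) * t) ≠ 0 := by
    simp only [hNc]
    exact right_ne_zero_of_mul hcr2
  obtain ⟨M₁, hM₁⟩ := hφ₁bdd
  obtain ⟨M₂, hM₂⟩ := hφ₂bdd
  have per2 := (A₁.osc2 hT).perC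
  have pC : ∀ σ, ∫ t in (0:ℝ)..(2 * π), p₁ t * C₁ (t + σ) = 0 := by
    intro σ
    have h := hΦ₁zero (n * σ)
    have hγ : γ₁ ≠ 0 := by rw [hγ₁]; positivity
    have h2 := (mul_eq_zero.1 h).resolve_left (neg_ne_zero.2 (div_ne_zero hγ two_ne_zero))
    rw [← h2]
    congr 1; funext t
    rw [mul_div_cancel_left₀ _ hn0.ne', add_comm σ t, mul_comm]
  have pC' : ∀ σ, ∫ t in (0:ℝ)..(2 * π), p₁ (-t) * C₁ (t + σ) = 0 := by
    intro σ
    have e := intervalIntegral.integral_comp_neg (a := (0:ℝ)) (b := 2 * π)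
      (fun t => p₁ t * C₁ (t + -σ))
    have e2 : ∀ t, C₁ (-t + -σ) = C₁ (t + σ) := fun t => by
      rw [← A₁.even (t + σ)]; congr 1; ring
    simp only [e2] at e
    rw [e]
    have hper : Function.Periodic (fun t => p₁ t * C₁ (t + -σ)) (2 * π) := fun t => by
      beta_reduce
      rw [hp₁per, show t + 2 * π + -σ = t + -σ + 2 * π by ring, per2]
    have := hper.intervalIntegral_add_eq (-(2 * π)) 0
    simp only [neg_add_cancel, zero_add] at this
    rw [neg_zero, this]
    exact pC (-σ)
  obtain ⟨μs, hμs, F⟩ := forward hn A₁ A₂ hT hα₁ h0 h1 hφ₁ne hN hκ hφ₁lip.continuous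
    hφ₂lip.continuous hM₁ hM₂ hφ₁top hφ₁bot
  refine ⟨μs, hμs, fun μ hμ => ?_⟩
  obtain ⟨E, hE1, hE2, hE3⟩ := F μ hμ p₁ hp₁ hp₁per pC
  obtain ⟨E', hE1', hE2', hE3'⟩ := F μ hμ (fun t => p₁ (-t)) (by fun_prop)
    (fun t => by
      rw [← hp₁per (-(t + 2 * π))]; congr 1; ring) pC'
  have mp : MeasurePreserving (fun z : ℝ × ℝ × ℝ × ℝ => (z.1, z.2.1, -z.2.2.1, -z.2.2.2))
      volume volume := by
    have hneg : MeasurePreserving (fun x : ℝ => -x) volume volume :=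
      Measure.measurePreserving_neg volume
    have hid : MeasurePreserving (fun x : ℝ => x) volume volume := MeasurePreserving.id volume
    exact hid.prod (hid.prod (hneg.prod hneg))
  refine ⟨E, (fun z : ℝ × ℝ × ℝ × ℝ => (z.1, z.2.1, -z.2.2.1, -z.2.2.2)) ⁻¹' E', hE1, hE2,
    mp.measurable hE1', ?_, ?_, ?_⟩
  · rw [mp.measure_preimage hE1'.nullMeasurableSet]; exact hE2'
  · intro x₁ x₂ v₁ v₂ so hin
    refine hE3 x₁ x₂ v₁ v₂ (fun t ht => ?_) (fun t ht => ?_) hin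
    · obtain ⟨d1, d2, d3, d4⟩ := so t ht
      exact ⟨d1, d3.congr_deriv (by unfold gg; ring)⟩
    · obtain ⟨d1, d2, d3, d4⟩ := so t ht
      exact ⟨d2, d4.congr_deriv (by rw [hNc]; unfold gg; ring)⟩
  · intro x₁ x₂ v₁ v₂ so hin
    have hrev : ∀ {f : ℝ → ℝ} {f' t : ℝ}, HasDerivAt f f' (-t) →
        HasDerivAt (fun s => f (-s)) (-f') t := by
      intro f f' t h
      have := h.comp t (hasDerivAt_neg t)
      exact this.congr_deriv (by ring)
    have := hE3' (fun t => x₁ (-t)) (fun t => x₂ (-t)) (fun t => -v₁ (-t)) (fun t => -v₂ (-t))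
      (fun t ht => ?_) (fun t ht => ?_) (by simpa using hin)
    · obtain ⟨t1, t2⟩ := this
      constructor
      · have := t1.comp tendsto_neg_atBot_atTop
        simpa [Function.comp_def] using this
      · have := t2.comp tendsto_neg_atBot_atTop
        simpa [Function.comp_def] using this
    · obtain ⟨d1, d2, d3, d4⟩ := so (-t) (by simpa using ht)
      exact ⟨hrev d1, (hrev d3).neg.congr_deriv (by unfold gg; ring)⟩
    · obtain ⟨d1, d2, d3, d4⟩ := so (-t) (by simpa using ht)
      refine ⟨hrev d2, (hrev d4).neg.congr_deriv ?_⟩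
      rw [hNc, mul_neg, Real.cos_neg]; unfold gg; ring
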